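/- arXiv:1504.05171 — 2 statements merged into one kernel-verified Lean document; each statement's English description precedes it below -/
import Mathlib

section
/- Let 1 ≤ κ ≤ n−1. Let D_κ ⊆ S_κ be the ℂ-linear span of all κ×κ minors of the generic n×n matrix, and let μ : D_κ ⊗ S_1 → S_{κ+1} be the multiplication map, p ⊗ ℓ ↦ p·ℓ. Then the kernel of μ (the space of linear first syzygies of the ideal of κ×κ minors) has dimension (2κ(n+1)/(n−κ)) · C(n, κ+1)²; equivalently, (n−κ) · dim ker(μ) = 2κ(n+1) · C(n, κ+1)². -/
open MvPolynomial TensorProduct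

set_option synthInstance.maxHeartbeats 1000000
set_option maxHeartbeats 1000000

/-- Helper instance: the type of a submodule of a tensor product of two `ℂ`-modules is an
additive commutative group (this merely assists instance search). -/
noncomputable local instance tensorSubAddCommGroup {M N : Type*} [AddCommGroup M]
    [AddCommGroup N] [Module ℂ M] [Module ℂ N] (k : Submodule ℂ (M ⊗[ℂ] N)) :
    AddCommGroup ↥k :=
  inferInstance

/-- The minor `det_{A,B}` of the generic `n × n` matrix `(x_{i,j})`: the determinant of the
`k × k` submatrix with row set `A` and column set `B` (listed in increasing order). -/
noncomputable def genericMinor {n : ℕ} (k : ℕ) (A B : Finset (Fin n)) (hA : A.card = k)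
    (hB : B.card = k) : MvPolynomial (Fin n × Fin n) ℂ :=
  Matrix.det (Matrix.of fun a b : Fin k =>
    X ((A.orderIsoOfFin hA a : Fin n), (B.orderIsoOfFin hB b : Fin n)))

namespace SyzMinors

open Matrix Equiv

section gen

variable {ι : Type} [Fintype ι] [DecidableEq ι] {n : ℕ}

/-- permutation operators on tensors -/
noncomputable def U (n : ℕ) (σ : Perm ι) : Matrix (ι → Fin n) (ι → Fin n) ℂ :=
  Matrix.of fun i k => if k = i ∘ σ then 1 else 0

theorem U_mul (σ τ : Perm ι) : U n σ * U n τ = U n (σ * τ) := by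
  ext i k
  simp only [U, Matrix.mul_apply, Matrix.of_apply, ite_mul, one_mul, zero_mul,
    Finset.sum_ite_eq', Finset.sum_ite_eq, Finset.mem_univ, if_true]
  rfl

theorem U_one : U n (1 : Perm ι) = 1 := by
  ext i k
  simp [U, Matrix.one_apply, eq_comm]

/-- the sign as a complex number -/
noncomputable def sg (σ : Perm ι) : ℂ := ((Perm.sign σ : ℤ) : ℂ)

theorem sg_mul (σ τ : Perm ι) : sg (σ * τ) = sg σ * sg τ := by simp [sg]

theorem sg_one : sg (1 : Perm ι) = 1 := by simp [sg]

theorem sg_sq (σ : Perm ι) : sg σ * sg σ = 1 := by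
  rcases Int.units_eq_one_or (Perm.sign σ) with h | h <;> simp [sg, h]

theorem sg_inv (σ : Perm ι) : sg (σ⁻¹) = sg σ := by simp [sg]

section hom

variable {G G' : Type} [Group G] [Fintype G] [Group G'] [Fintype G']

/-- antisymmetrizer -/
noncomputable def E (n : ℕ) (φ : G →* Perm ι) : Matrix (ι → Fin n) (ι → Fin n) ℂ :=
  ∑ g, sg (φ g) • U n (φ g)

theorem E_mul_U (φ : G →* Perm ι) (g : G) : E n φ * U n (φ g) = sg (φ g) • E n φ := by
  unfold E
  rw [Finset.sum_mul, Finset.smul_sum]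
  refine Fintype.sum_equiv (Equiv.mulRight g) _ _ fun h => ?_
  simp only [Equiv.coe_mulRight, map_mul, sg_mul, smul_mul_assoc, U_mul, smul_smul]
  rw [mul_left_comm, sg_sq, mul_one]

theorem U_mul_E (φ : G →* Perm ι) (g : G) : U n (φ g) * E n φ = sg (φ g) • E n φ := by
  unfold E
  rw [Finset.mul_sum, Finset.smul_sum]
  refine Fintype.sum_equiv (Equiv.mulLeft g) _ _ fun h => ?_
  simp only [Equiv.coe_mulLeft, map_mul, sg_mul, mul_smul_comm, U_mul, smul_smul]
  rw [← mul_assoc, sg_sq, one_mul]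

theorem E_mul_E (φ : G →* Perm ι) (ψ : G' →* Perm ι) (h : ∀ g', ∃ g, ψ g' = φ g) :
    E n φ * E n ψ = (Fintype.card G' : ℂ) • E n φ := by
  conv_lhs => rw [E.eq_def n ψ]
  rw [Finset.mul_sum]
  have : ∀ g', E n φ * sg (ψ g') • U n (ψ g') = E n φ := by
    intro g'
    obtain ⟨g, hg⟩ := h g'
    rw [hg, mul_smul_comm, E_mul_U, smul_smul, sg_sq, one_smul]
  simp [this, Nat.cast_smul_eq_nsmul]

theorem E_mul_E' (φ : G →* Perm ι) (ψ : G' →* Perm ι) (h : ∀ g', ∃ g, ψ g' = φ g) :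
    E n ψ * E n φ = (Fintype.card G' : ℂ) • E n φ := by
  conv_lhs => rw [E.eq_def n ψ]
  rw [Finset.sum_mul]
  have : ∀ g', (sg (ψ g') • U n (ψ g')) * E n φ = E n φ := by
    intro g'
    obtain ⟨g, hg⟩ := h g'
    rw [hg, smul_mul_assoc, U_mul_E, smul_smul, sg_sq, one_smul]
  simp [this, Nat.cast_smul_eq_nsmul]

end hom

theorem trace_U (σ : Perm ι) :
    (U n σ).trace = ∑ i : ι → Fin n, if i = i ∘ σ then (1:ℂ) else 0 := by
  simp [U, Matrix.trace]

theorem sum_sg_stab (i : ι → Fin n) :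
    (∑ σ : Perm ι, if i = i ∘ σ then sg σ else 0) = if Function.Injective i then 1 else 0 := by
  split_ifs with h
  · rw [Finset.sum_eq_single 1]
    · simp [sg_one]
    · intro σ _ hσ
      rw [if_neg]
      intro h'
      apply hσ
      ext p
      simpa using (h (congrFun h' p)).symm
    · simp
  · simp only [Function.Injective, not_forall] at h
    obtain ⟨p, q, hpq, hne⟩ := h
    have key : (∑ σ : Perm ι, if i = i ∘ σ then sg σ else 0) =
        ∑ σ : Perm ι, -(if i = i ∘ σ then sg σ else 0) := by
      refine Fintype.sum_equiv (Equiv.mulLeft (swap p q)) _ _ fun σ => ?_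
      have hs : i ∘ (swap p q) = i := by
        ext r
        simp only [Function.comp_apply]
        rcases eq_or_ne r p with rfl | h1
        · simp [hpq]
        · rcases eq_or_ne r q with rfl | h2
          · simp [hpq]
          · rw [swap_apply_of_ne_of_ne h1 h2]
      have : i ∘ ((swap p q * σ : Perm ι)) = i ∘ σ := by
        rw [Perm.coe_mul, ← Function.comp_assoc, hs]
      simp only [Equiv.coe_mulLeft, this, sg_mul]
      have h2 : sg (swap p q) = -1 := by simp [sg, Perm.sign_swap hne]
      rw [h2]
      split_ifs <;> simp
    rw [Finset.sum_neg_distrib] at key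
    exact self_eq_neg.mp key

theorem trace_E_id :
    (E n (MonoidHom.id (Perm ι))).trace = (n.descFactorial (Fintype.card ι) : ℂ) := by
  unfold E
  simp only [Matrix.trace_sum, Matrix.trace_smul, MonoidHom.id_apply, trace_U, smul_eq_mul,
    Finset.mul_sum, mul_ite, mul_one, mul_zero]
  rw [Finset.sum_comm]
  simp only [sum_sg_stab]
  rw [Finset.sum_boole]
  congr 1
  rw [← Fintype.card_subtype, ← Fintype.card_congr (Equiv.subtypeInjectiveEquivEmbedding ι (Fin n)) |>.symm,
    Fintype.card_embedding_eq, Fintype.card_fin]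

/-- exponent vector of the monomial attached to a pair of tuples -/
noncomputable def expo (z : (ι → Fin n) × (ι → Fin n)) : (Fin n × Fin n) →₀ ℕ :=
  ∑ p, Finsupp.single (z.1 p, z.2 p) 1

/-- the monomial attached to a pair of tuples -/
noncomputable def mono (z : (ι → Fin n) × (ι → Fin n)) : MvPolynomial (Fin n × Fin n) ℂ :=
  ∏ p, X (z.1 p, z.2 p)

theorem mono_eq (z : (ι → Fin n) × (ι → Fin n)) : mono z = monomial (expo z) 1 := by
  unfold mono expo
  rw [MvPolynomial.monomial_sum_one]
  rfl

theorem mono_comp (z : (ι → Fin n) × (ι → Fin n)) (σ : Perm ι) :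
    mono (z.1 ∘ σ, z.2 ∘ σ) = mono z := by
  unfold mono
  exact Fintype.prod_equiv σ _ _ fun p => rfl

theorem expo_comp (z : (ι → Fin n) × (ι → Fin n)) (σ : Perm ι) :
    expo (z.1 ∘ σ, z.2 ∘ σ) = expo z := by
  unfold expo
  exact Fintype.sum_equiv σ _ _ fun p => rfl

theorem exists_perm (z w : (ι → Fin n) × (ι → Fin n)) (h : expo z = expo w) :
    ∃ σ : Perm ι, w = (z.1 ∘ σ, z.2 ∘ σ) := by
  have hc : ∀ z : (ι → Fin n) × (ι → Fin n), ∀ c,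
      expo z c = Fintype.card {p // (z.1 p, z.2 p) = c} := by
    intro z c
    unfold expo
    rw [Finsupp.finsetSum_apply, Fintype.card_subtype, Finset.card_filter]
    simp [Finsupp.single_apply]
  have e : ∀ c, Nonempty ({p // (w.1 p, w.2 p) = c} ≃ {p // (z.1 p, z.2 p) = c}) := by
    intro c
    rw [← Fintype.card_eq, ← hc, ← hc, h]
  refine ⟨Equiv.ofFiberEquiv fun c => (e c).some, ?_⟩
  have := fun p => Equiv.ofFiberEquiv_map (fun c => (e c).some) p
  ext p
  · have := congrArg (fun t => (t.1 : ℕ)) (this p)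
    exact this.symm
  · have := congrArg (fun t => (t.2 : ℕ)) (this p)
    exact this.symm

/-- the map from tensors to polynomials -/
noncomputable def pi : ((ι → Fin n) × (ι → Fin n) → ℂ) →ₗ[ℂ] MvPolynomial (Fin n × Fin n) ℂ :=
  Fintype.linearCombination ℂ mono

theorem pi_apply (f : (ι → Fin n) × (ι → Fin n) → ℂ) : pi f = ∑ z, f z • mono z := rfl

/-- `A ⊗ B` as an operator -/
noncomputable def kr (A B : Matrix (ι → Fin n) (ι → Fin n) ℂ) :
    ((ι → Fin n) × (ι → Fin n) → ℂ) →ₗ[ℂ] ((ι → Fin n) × (ι → Fin n) → ℂ) :=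
  (Matrix.kronecker A B).mulVecLin

theorem kr_mul (A B C D : Matrix (ι → Fin n) (ι → Fin n) ℂ) :
    kr A B ∘ₗ kr C D = kr (A * C) (B * D) := by
  unfold kr
  rw [← Matrix.mulVecLin_mul]
  congr 1
  exact (Matrix.mul_kronecker_mul A C B D).symm

theorem kr_add_left (A B C : Matrix (ι → Fin n) (ι → Fin n) ℂ) :
    kr (A + B) C = kr A C + kr B C := by
  unfold kr
  rw [← Matrix.mulVecLin_add]
  congr 1
  exact Matrix.add_kronecker _ _ _

theorem kr_add_right (A B C : Matrix (ι → Fin n) (ι → Fin n) ℂ) :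
    kr A (B + C) = kr A B + kr A C := by
  unfold kr
  rw [← Matrix.mulVecLin_add]
  congr 1
  exact Matrix.kronecker_add _ _ _

theorem kr_smul_left (c : ℂ) (A C : Matrix (ι → Fin n) (ι → Fin n) ℂ) :
    kr (c • A) C = c • kr A C := by
  unfold kr
  have := congrArg Matrix.mulVecLin (Matrix.smul_kronecker c A C)
  refine this.trans ?_
  exact LinearMap.ext fun f => Matrix.smul_mulVec c (Matrix.kronecker A C) f

theorem kr_smul_right (c : ℂ) (A C : Matrix (ι → Fin n) (ι → Fin n) ℂ) :
    kr A (c • C) = c • kr A C := by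
  unfold kr
  have := congrArg Matrix.mulVecLin (Matrix.kronecker_smul c A C)
  refine this.trans ?_
  exact LinearMap.ext fun f => Matrix.smul_mulVec c (Matrix.kronecker A C) f

theorem kr_zero_left (A : Matrix (ι → Fin n) (ι → Fin n) ℂ) : kr 0 A = 0 := by
  simpa using kr_smul_left 0 0 A

theorem kr_zero_right (A : Matrix (ι → Fin n) (ι → Fin n) ℂ) : kr A 0 = 0 := by
  simpa using kr_smul_right 0 A 0

theorem kr_sum_left {α : Type} (s : Finset α) (A : α → Matrix (ι → Fin n) (ι → Fin n) ℂ)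
    (C : Matrix (ι → Fin n) (ι → Fin n) ℂ) : kr (∑ x ∈ s, A x) C = ∑ x ∈ s, kr (A x) C := by
  classical
  induction s using Finset.induction_on with
  | empty => simp [kr_zero_left]
  | insert a s ha ih => rw [Finset.sum_insert ha, Finset.sum_insert ha, kr_add_left, ih]

theorem kr_sum_right {α : Type} (s : Finset α) (A : α → Matrix (ι → Fin n) (ι → Fin n) ℂ)
    (C : Matrix (ι → Fin n) (ι → Fin n) ℂ) : kr C (∑ x ∈ s, A x) = ∑ x ∈ s, kr C (A x) := by
  classical
  induction s using Finset.induction_on with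
  | empty => simp [kr_zero_right]
  | insert a s ha ih => rw [Finset.sum_insert ha, Finset.sum_insert ha, kr_add_right, ih]

theorem trace_kr (A B : Matrix (ι → Fin n) (ι → Fin n) ℂ) :
    LinearMap.trace ℂ _ (kr A B) = A.trace * B.trace := by
  rw [kr, ← Matrix.toLin'_apply', Matrix.trace_toLin'_eq]
  exact Matrix.trace_kronecker A B

theorem kr_UU (σ τ : Perm ι) (f : (ι → Fin n) × (ι → Fin n) → ℂ) (i j : ι → Fin n) :
    kr (U n σ) (U n τ) f (i, j) = f (i ∘ σ, j ∘ τ) := by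
  have : kr (U n σ) (U n τ) f (i, j) =
    ∑ z : (ι → Fin n) × (ι → Fin n), (U n σ i z.1 * U n τ j z.2) * f z := rfl
  rw [this, Finset.sum_eq_single (i ∘ σ, j ∘ τ)]
  · simp [U]
  · rintro ⟨k, l⟩ _ h
    have : ¬ (k = i ∘ σ ∧ l = j ∘ τ) := by simpa using h
    by_cases h1 : k = i ∘ σ
    · have h2 : ¬ l = j ∘ τ := fun h2 => this ⟨h1, h2⟩
      simp [U, h2]
    · simp [U, h1]
  · simp

theorem pi_kr_UU (σ τ : Perm ι) (f : (ι → Fin n) × (ι → Fin n) → ℂ) :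
    pi (kr (U n σ) (U n τ) f) =
      ∑ z : (ι → Fin n) × (ι → Fin n), f z • mono (z.1 ∘ ⇑σ⁻¹, z.2 ∘ ⇑τ⁻¹) := by
  rw [pi_apply]
  refine Fintype.sum_equiv ((Equiv.arrowCongr σ⁻¹ (Equiv.refl _)).prodCongr
    (Equiv.arrowCongr τ⁻¹ (Equiv.refl _))) _ _ fun z => ?_
  obtain ⟨i, j⟩ := z
  rw [kr_UU]
  have h : ∀ (σ : Perm ι) (i : ι → Fin n),
      (Equiv.arrowCongr σ⁻¹ (Equiv.refl (Fin n))) i = i ∘ σ := by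
    intro σ i; rfl
  have h' : ∀ (σ : Perm ι) (i : ι → Fin n), (i ∘ σ) ∘ ⇑σ⁻¹ = i := by
    intro σ i; ext p; simp
  simp only [Equiv.prodCongr_apply, Prod.map_apply, h, h']

theorem pi_UU (σ : Perm ι) : pi ∘ₗ kr (U n σ) (U n σ) = pi := by
  refine LinearMap.ext fun f => ?_
  rw [LinearMap.comp_apply, pi_kr_UU, pi_apply]
  simp only [mono_comp]

theorem pi_U_left (σ : Perm ι) : pi ∘ₗ kr (U n σ) 1 = pi ∘ₗ kr 1 (U n σ⁻¹) := by
  conv_rhs => rw [← pi_UU σ, LinearMap.comp_assoc, kr_mul, U_mul, mul_one, mul_inv_cancel, U_one]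

theorem comp_sum' {α V W Z : Type*} [AddCommGroup V] [AddCommGroup W] [AddCommGroup Z]
    [Module ℂ V] [Module ℂ W] [Module ℂ Z] (s : Finset α) (f : W →ₗ[ℂ] Z) (g : α → V →ₗ[ℂ] W) :
    f ∘ₗ (∑ x ∈ s, g x) = ∑ x ∈ s, f ∘ₗ g x := by
  ext v; simp

theorem sum_comp' {α V W Z : Type*} [AddCommGroup V] [AddCommGroup W] [AddCommGroup Z]
    [Module ℂ V] [Module ℂ W] [Module ℂ Z] (s : Finset α) (g : α → W →ₗ[ℂ] Z) (f : V →ₗ[ℂ] W) :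
    (∑ x ∈ s, g x) ∘ₗ f = ∑ x ∈ s, g x ∘ₗ f := by
  ext v; simp

theorem pi_E {G : Type} [Group G] [Fintype G] (φ : G →* Perm ι) :
    pi ∘ₗ kr (E n φ) 1 = pi ∘ₗ kr 1 (E n φ) := by
  unfold E
  simp only [kr_sum_left, kr_sum_right, comp_sum', kr_smul_left, kr_smul_right,
    LinearMap.comp_smul, pi_U_left]
  refine Fintype.sum_equiv (Equiv.inv G) _ _ fun g => ?_
  simp [sg_inv]

theorem pi_E_apply {G : Type} [Group G] [Fintype G] (φ : G →* Perm ι)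
    (f : (ι → Fin n) × (ι → Fin n) → ℂ) :
    pi (kr (E n φ) 1 f) = ∑ z : (ι → Fin n) × (ι → Fin n),
      f z • ∑ g : G, sg (φ g) • mono (z.1 ∘ φ g, z.2) := by
  unfold E
  rw [← U_one]
  simp only [kr_sum_left, kr_smul_left, LinearMap.sum_apply, map_sum, LinearMap.smul_apply,
    map_smul, pi_kr_UU, Finset.smul_sum]
  rw [Finset.sum_comm]
  refine Finset.sum_congr rfl fun z _ => ?_
  refine Fintype.sum_equiv (Equiv.inv G) _ _ fun g => ?_
  rw [smul_comm]
  simp [sg_inv]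

/-- size of the stabilizer -/
def st (w : (ι → Fin n) × (ι → Fin n)) : ℕ :=
  (Finset.univ.filter fun σ : Perm ι => (w.1 ∘ σ, w.2 ∘ σ) = w).card

theorem card_st (w z : (ι → Fin n) × (ι → Fin n)) :
    (Finset.univ.filter fun σ : Perm ι => (w.1 ∘ σ, w.2 ∘ σ) = z).card =
      if expo z = expo w then st w else 0 := by
  split_ifs with h
  · obtain ⟨τ, hτ⟩ := exists_perm z w h
    unfold st
    refine Finset.card_equiv (Equiv.mulRight τ) fun σ => ?_
    subst hτ
    simp only [Finset.mem_filter, Finset.mem_univ, true_and, Equiv.coe_mulRight, Perm.coe_mul,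
      Function.comp_assoc, Prod.ext_iff]
    constructor
    · rintro ⟨h1, h2⟩
      rw [← Function.comp_assoc] at h1 h2
      constructor
      · conv_rhs => rw [← h1]
        rfl
      · conv_rhs => rw [← h2]
        rfl
    · rintro ⟨h1, h2⟩
      have hc : ∀ (i i' : ι → Fin n), i ∘ τ = i' ∘ τ → i = i' := by
        intro i i' hh
        ext p
        simpa using congrArg Fin.val (congrFun hh (τ⁻¹ p))
      exact ⟨hc _ _ h1, hc _ _ h2⟩
  · rw [Finset.card_eq_zero, Finset.filter_eq_empty_iff]
    rintro σ - rfl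
    exact h (expo_comp w σ)

/-- polarization -/
noncomputable def rho : MvPolynomial (Fin n × Fin n) ℂ →ₗ[ℂ] ((ι → Fin n) × (ι → Fin n) → ℂ) :=
  LinearMap.pi fun w => (st w : ℂ) • MvPolynomial.lcoeff ℂ (expo w)

/-- diagonal symmetrizer -/
noncomputable def Sy (ι : Type) [Fintype ι] [DecidableEq ι] (n : ℕ) :
    ((ι → Fin n) × (ι → Fin n) → ℂ) →ₗ[ℂ] ((ι → Fin n) × (ι → Fin n) → ℂ) :=
  ∑ σ : Perm ι, kr (U n σ) (U n σ)

theorem rho_pi : rho ∘ₗ pi = Sy ι n := by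
  refine LinearMap.ext fun f => funext fun w => ?_
  obtain ⟨i, j⟩ := w
  have h1 : Sy ι n f (i, j) = ∑ σ : Perm ι, f (i ∘ σ, j ∘ σ) := by
    simp [Sy, LinearMap.sum_apply, kr_UU]
  have h2 : (∑ σ : Perm ι, f (i ∘ σ, j ∘ σ)) =
      ∑ z, ∑ σ : Perm ι, if (i ∘ σ, j ∘ σ) = z then f z else 0 := by
    rw [Finset.sum_comm]; simp
  rw [h1, h2, LinearMap.comp_apply, pi_apply, rho, LinearMap.pi_apply]
  simp only [LinearMap.smul_apply, map_sum, map_smul, mono_eq, MvPolynomial.lcoeff_apply,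
    MvPolynomial.coeff_monomial, Finset.smul_sum, smul_eq_mul]
  refine Finset.sum_congr rfl fun z _ => ?_
  rw [← Finset.sum_filter, Finset.sum_const, card_st (i, j) z]
  split_ifs <;> simp [mul_comm]

theorem rank_idem {V W : Type*} [AddCommGroup V] [AddCommGroup W]
    [Module ℂ V] [Module ℂ W] [FiniteDimensional ℂ V] (P : V →ₗ[ℂ] V) (hP : P ∘ₗ P = P)
    (T : V →ₗ[ℂ] W) (Q : W →ₗ[ℂ] V) (h : Q ∘ₗ T ∘ₗ P = P) :
    (Module.finrank ℂ (LinearMap.range (T ∘ₗ P)) : ℂ) = LinearMap.trace ℂ V P := by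
  have hp : LinearMap.IsProj (LinearMap.range P) P :=
    ⟨fun x => ⟨x, rfl⟩, by rintro _ ⟨x, rfl⟩; exact LinearMap.congr_fun hP x⟩
  rw [hp.trace]
  congr 1
  apply le_antisymm
  · rw [LinearMap.range_comp]
    exact Submodule.finrank_map_le _ _
  · have : LinearMap.range P = (LinearMap.range (T ∘ₗ P)).map Q := by
      rw [← LinearMap.range_comp, h]
    conv_lhs => rw [this]
    exact Submodule.finrank_map_le _ _

end gen

section rank1

variable {ι : Type} [Fintype ι] [DecidableEq ι] {n : ℕ}

/-- normalized full antisymmetrizer -/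
noncomputable def aa (ι : Type) [Fintype ι] [DecidableEq ι] (n : ℕ) :
    Matrix (ι → Fin n) (ι → Fin n) ℂ :=
  ((Fintype.card (Perm ι) : ℂ))⁻¹ • E n (MonoidHom.id (Perm ι))

theorem card_perm_ne : (Fintype.card (Perm ι) : ℂ) ≠ 0 := by
  exact_mod_cast Fintype.card_ne_zero

theorem aa_mul_U (σ : Perm ι) : aa ι n * U n σ = sg σ • aa ι n := by
  unfold aa
  have := E_mul_U (n := n) (MonoidHom.id (Perm ι)) σ
  simp only [MonoidHom.id_apply] at this
  rw [smul_mul_assoc, this, smul_comm]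

theorem U_mul_aa (σ : Perm ι) : U n σ * aa ι n = sg σ • aa ι n := by
  unfold aa
  have := U_mul_E (n := n) (MonoidHom.id (Perm ι)) σ
  simp only [MonoidHom.id_apply] at this
  rw [mul_smul_comm, this, smul_comm]

theorem aa_mul_aa : aa ι n * aa ι n = aa ι n := by
  unfold aa
  rw [smul_mul_assoc, mul_smul_comm, E_mul_E _ _ (fun g => ⟨g, rfl⟩), smul_smul _ _ (E n _),
    inv_mul_cancel₀ card_perm_ne, one_smul]

theorem trace_aa : (aa ι n).trace = (n.choose (Fintype.card ι) : ℂ) := by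
  unfold aa
  rw [Matrix.trace_smul, trace_E_id, Fintype.card_perm, Nat.descFactorial_eq_factorial_mul_choose,
    smul_eq_mul]
  push_cast
  rw [inv_mul_cancel_left₀]
  exact_mod_cast Nat.factorial_ne_zero _

theorem pi_aa : pi ∘ₗ kr (aa ι n) 1 = pi ∘ₗ kr 1 (aa ι n) := by
  unfold aa
  rw [kr_smul_left, kr_smul_right, LinearMap.comp_smul, LinearMap.comp_smul, pi_E]

theorem pi_aa_aa : pi ∘ₗ kr (aa ι n) 1 = pi ∘ₗ kr (aa ι n) (aa ι n) := by
  have : kr (aa ι n) (aa ι n) = kr (aa ι n) 1 ∘ₗ kr 1 (aa ι n) := by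
    rw [kr_mul, mul_one, one_mul]
  rw [this, ← LinearMap.comp_assoc, pi_aa, LinearMap.comp_assoc, kr_mul, aa_mul_aa, mul_one]

theorem Sy_aa : Sy ι n ∘ₗ kr (aa ι n) (aa ι n) =
    (Fintype.card (Perm ι) : ℂ) • kr (aa ι n) (aa ι n) := by
  unfold Sy
  rw [sum_comp']
  simp only [kr_mul, U_mul_aa, kr_smul_left, kr_smul_right, smul_smul, sg_sq, one_smul]
  simp [Nat.cast_smul_eq_nsmul]

theorem rank_pi_aa :
    Module.finrank ℂ (LinearMap.range (pi ∘ₗ kr (E n (MonoidHom.id (Perm ι))) 1)) =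
      n.choose (Fintype.card ι) ^ 2 := by
  have h0 : LinearMap.range (pi ∘ₗ kr (E n (MonoidHom.id (Perm ι))) 1) =
      LinearMap.range (pi ∘ₗ kr (aa ι n) (aa ι n)) := by
    rw [← pi_aa_aa, aa, kr_smul_left, LinearMap.comp_smul, LinearMap.range_smul]
    exact inv_ne_zero card_perm_ne
  rw [h0]
  have := rank_idem (kr (aa ι n) (aa ι n)) (by rw [kr_mul, aa_mul_aa]) pi
    ((Fintype.card (Perm ι) : ℂ)⁻¹ • rho) (by
      rw [← LinearMap.comp_assoc, LinearMap.smul_comp, rho_pi, LinearMap.smul_comp, Sy_aa,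
        smul_smul, inv_mul_cancel₀ card_perm_ne, one_smul])
  rw [trace_kr, trace_aa] at this
  rw [sq]
  exact_mod_cast this

end rank1

section rank2

variable {k n : ℕ}

/-- stabilizer of `none` -/
def hat (k : ℕ) : Perm (Fin k) →* Perm (Option (Fin k)) where
  toFun := Equiv.optionCongr
  map_one' := Equiv.optionCongr_one
  map_mul' σ τ := by
    ext1 x
    cases x <;> rfl

theorem exists_hat (σ : Perm (Option (Fin k))) (h : σ none = none) : ∃ τ, σ = hat k τ := by
  refine ⟨Equiv.removeNone σ, ?_⟩
  ext1 x
  cases x with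
  | none => simpa [hat] using h
  | some x =>
    have : σ (some x) ≠ none := fun h' => by
      have := σ.injective (h'.trans h.symm)
      cases this
    obtain ⟨y, hy⟩ := Option.ne_none_iff_exists'.mp this
    have := Equiv.removeNone_some σ ⟨y, hy⟩
    exact this.symm

theorem hat_none (τ : Perm (Fin k)) : hat k τ none = none := rfl

theorem sg_hat (τ : Perm (Fin k)) : sg (hat k τ) = sg τ := by
  simp [sg, hat, Equiv.optionCongr_sign]

/-- normalized partial antisymmetrizer -/
noncomputable def ee (k n : ℕ) : Matrix (Option (Fin k) → Fin n) (Option (Fin k) → Fin n) ℂ :=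
  ((Fintype.card (Perm (Fin k)) : ℂ))⁻¹ • E n (hat k)

local notation "ak" => aa (Option (Fin k)) n
local notation "ek" => ee k n

theorem ee_mul_U (τ : Perm (Fin k)) : ek * U n (hat k τ) = sg (hat k τ) • ek := by
  unfold ee
  rw [smul_mul_assoc, E_mul_U, smul_comm]

theorem U_mul_ee (τ : Perm (Fin k)) : U n (hat k τ) * ek = sg (hat k τ) • ek := by
  unfold ee
  rw [mul_smul_comm, U_mul_E, smul_comm]

theorem ee_mul_ee : ek * ek = ek := by
  unfold ee
  rw [smul_mul_assoc, mul_smul_comm, E_mul_E _ _ (fun g => ⟨g, rfl⟩), smul_smul _ _ (E n _),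
    inv_mul_cancel₀ card_perm_ne, one_smul]

theorem ee_mul_aa : ek * ak = ak := by
  unfold ee aa
  rw [smul_mul_assoc, mul_smul_comm, E_mul_E' (MonoidHom.id _) (hat k) (fun g => ⟨_, rfl⟩),
    smul_comm _ (Fintype.card (Perm (Fin k)) : ℂ) (E n _), inv_smul_smul₀ card_perm_ne]

theorem aa_mul_ee : ak * ek = ak := by
  unfold ee aa
  rw [smul_mul_assoc, mul_smul_comm, E_mul_E (MonoidHom.id _) (hat k) (fun g => ⟨_, rfl⟩),
    smul_smul _ _ (E n _), inv_mul_cancel₀ card_perm_ne, one_smul]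

theorem trace_ee : (ek).trace = (n * n.choose k : ℂ) := by
  have h := trace_aa (ι := Fin k) (n := n)
  unfold aa at h
  rw [Fintype.card_fin, Matrix.trace_smul] at h
  unfold ee
  rw [← h, Matrix.trace_smul, smul_eq_mul, smul_eq_mul, mul_left_comm]
  congr 1
  unfold E
  simp only [Matrix.trace_sum, Matrix.trace_smul, MonoidHom.id_apply, trace_U, smul_eq_mul, sg_hat]
  rw [Finset.mul_sum]
  refine Finset.sum_congr rfl fun σ _ => ?_
  rw [mul_left_comm]
  congr 1
  rw [Fintype.sum_equiv (Equiv.piOptionEquivProd (α := Fin k) (β := fun _ => Fin n)) _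
    (fun z : Fin n × (Fin k → Fin n) => if z.2 = z.2 ∘ σ then (1 : ℂ) else 0)]
  · rw [Fintype.sum_prod_type]
    simp
  · intro i
    have : (i = i ∘ hat k σ) ↔
        (Equiv.piOptionEquivProd (α := Fin k) (β := fun _ => Fin n) i).2 =
        (Equiv.piOptionEquivProd (α := Fin k) (β := fun _ => Fin n) i).2 ∘ σ := by
      constructor
      · intro h
        ext p
        exact congrArg Fin.val (congrFun h (some p))
      · intro h
        funext p
        cases p with
        | none => rfl
        | some p => exact congrFun h p
    simp only [this]

theorem double_coset (σ σ' : Perm (Option (Fin k))) (h : σ none ≠ none) (h' : σ' none ≠ none) :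
    ∃ τ τ', σ' = hat k τ * σ * hat k τ' := by
  obtain ⟨τ, hτ⟩ := exists_hat (swap (σ none) (σ' none))
    (swap_apply_of_ne_of_ne h.symm h'.symm)
  obtain ⟨τ', hτ'⟩ := exists_hat ((hat k τ * σ)⁻¹ * σ') (by
    rw [← hτ]; simp)
  exact ⟨τ, τ', by rw [← hτ']; group⟩

/-- the complement idempotent -/
noncomputable def ll (k n : ℕ) : Matrix (Option (Fin k) → Fin n) (Option (Fin k) → Fin n) ℂ :=
  ee k n - aa (Option (Fin k)) n

local notation "lk" => ll k n

theorem ll_mul_ll : lk * lk = lk := by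
  unfold ll
  rw [sub_mul, mul_sub, mul_sub, ee_mul_ee, ee_mul_aa, aa_mul_ee, aa_mul_aa]; simp

theorem ll_mul_aa : lk * ak = 0 := by
  unfold ll
  rw [sub_mul, ee_mul_aa, aa_mul_aa, sub_self]

theorem aa_mul_ll : ak * lk = 0 := by
  unfold ll
  rw [mul_sub, aa_mul_ee, aa_mul_aa, sub_self]

theorem ll_mul_ee : lk * ek = lk := by
  unfold ll
  rw [sub_mul, ee_mul_ee, aa_mul_ee]

theorem ee_mul_ll : ek * lk = lk := by
  unfold ll
  rw [mul_sub, ee_mul_ee, ee_mul_aa]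

theorem sg_double (τ τ' : Perm (Fin k)) (σ : Perm (Option (Fin k))) :
    sg (hat k τ * σ * hat k τ') • (ek * U n (hat k τ * σ * hat k τ') * ek) =
      sg σ • (ek * U n σ * ek) := by
  rw [← U_mul, ← U_mul, ← mul_assoc ek, ← mul_assoc ek, ee_mul_U, mul_assoc _ (U n (hat k τ')) ek,
    U_mul_ee]
  simp only [smul_mul_assoc, mul_smul_comm, smul_smul, sg_mul]
  congr 1
  have h1 := sg_sq (hat k τ)
  have h2 := sg_sq (hat k τ')
  linear_combination (sg σ * sg (hat k τ') * sg (hat k τ')) * h1 + sg σ * h2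

theorem exists_chi (hk : 1 ≤ k) (σ : Perm (Option (Fin k))) :
    ∃ c : ℝ, lk * U n σ * lk = (c : ℂ) • lk ∧ (σ = 1 → c = 1) := by
  by_cases h : σ none = none
  · obtain ⟨τ, hτ⟩ := exists_hat σ h
    refine ⟨((Perm.sign σ : ℤ) : ℝ), ?_, ?_⟩
    · have h1 : lk * U n σ = sg σ • lk := by
        conv_lhs => rw [← ll_mul_ee, mul_assoc, hτ, ee_mul_U, mul_smul_comm, ll_mul_ee, ← hτ]
      rw [h1, smul_mul_assoc, ll_mul_ll]
      simp [sg]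
    · rintro rfl; simp
  · set Y := sg σ • (ek * U n σ * ek) with hY
    set B := (Finset.univ.filter fun σ : Perm (Option (Fin k)) => ¬ σ none = none) with hB
    set F := (Finset.univ.filter fun σ : Perm (Option (Fin k)) => σ none = none) with hF
    have hBpos : (B.card : ℂ) ≠ 0 := by
      have : σ ∈ B := by simp [hB, h]
      exact_mod_cast (Finset.card_pos.mpr ⟨σ, this⟩).ne'
    have h1 : ∀ s ∈ B, sg s • (ek * U n s * ek) = Y := by
      intro s hs
      obtain ⟨τ, τ', rfl⟩ := double_coset σ s h (by simpa [hB] using hs)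
      exact sg_double τ τ' σ
    have h2 : ∀ s ∈ F, sg s • (ek * U n s * ek) = ek := by
      intro s hs
      obtain ⟨τ, rfl⟩ := exists_hat s (by simpa [hF] using hs)
      rw [ee_mul_U, smul_mul_assoc, smul_smul, sg_sq, one_smul, ee_mul_ee]
    have h3 : ∑ s, sg s • (ek * U n s * ek) = (Fintype.card (Perm (Option (Fin k))) : ℂ) • ak := by
      have : E n (MonoidHom.id (Perm (Option (Fin k)))) =
          (Fintype.card (Perm (Option (Fin k))) : ℂ) • ak := by
        rw [aa, smul_smul, mul_inv_cancel₀ card_perm_ne, one_smul]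
      have h4 : ek * E n (MonoidHom.id (Perm (Option (Fin k)))) * ek =
          (Fintype.card (Perm (Option (Fin k))) : ℂ) • ak := by
        rw [this, mul_smul_comm, smul_mul_assoc, ee_mul_aa, aa_mul_ee]
      rw [← h4, E, Finset.mul_sum, Finset.sum_mul]
      simp
    rw [← Finset.sum_filter_add_sum_filter_not _ (fun s : Perm (Option (Fin k)) => s none = none),
      ← hF, ← hB, Finset.sum_congr rfl h1, Finset.sum_congr rfl h2, Finset.sum_const,
      Finset.sum_const, ← Nat.cast_smul_eq_nsmul ℂ, ← Nat.cast_smul_eq_nsmul ℂ] at h3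
    have h5 : lk * Y * lk = sg σ • (lk * U n σ * lk) := by
      rw [hY, mul_smul_comm, smul_mul_assoc]
      congr 1
      rw [← mul_assoc, ← mul_assoc, ll_mul_ee, mul_assoc _ ek, ee_mul_ll]
    have h6 := congrArg (fun M => lk * M * lk) h3
    simp only [mul_add, add_mul, mul_smul_comm, smul_mul_assoc, ll_mul_aa, ll_mul_ee, ll_mul_ll,
      zero_mul, smul_zero, h5] at h6
    have h7 : lk * U n σ * lk = (sg σ * (-(F.card : ℂ) / B.card)) • lk := by
      have h8 : (B.card : ℂ) • sg σ • (lk * U n σ * lk) = -((F.card : ℂ) • lk) :=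
        eq_neg_of_add_eq_zero_right h6
      have h9 := congrArg (fun M => (sg σ * (B.card : ℂ)⁻¹) • M) h8
      simp only [smul_smul, smul_neg] at h9
      have h10 : sg σ * (B.card : ℂ)⁻¹ * ((B.card : ℂ) * sg σ) = 1 := by
        have := sg_sq σ
        field_simp
        linear_combination this
      rw [h10, one_smul] at h9
      rw [h9, ← neg_smul]
      congr 1
      field_simp
    refine ⟨((Perm.sign σ : ℤ) : ℝ) * (-(F.card : ℝ) / B.card), ?_, ?_⟩
    · rw [h7]
      simp [sg]
    · rintro rfl
      exact absurd rfl h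

theorem exists_s (hk : 1 ≤ k) : ∃ s : ℂ, s ≠ 0 ∧ kr lk lk ∘ₗ Sy (Option (Fin k)) n ∘ₗ kr lk lk =
    s • kr lk lk := by
  choose c hc using fun σ => exists_chi (n := n) hk σ
  refine ⟨((∑ σ, c σ * c σ : ℝ) : ℂ), ?_, ?_⟩
  · have : 0 < ∑ σ, c σ * c σ := by
      refine Finset.sum_pos' (fun σ _ => mul_self_nonneg _) ⟨1, Finset.mem_univ _, ?_⟩
      rw [(hc 1).2 rfl]; norm_num
    exact_mod_cast this.ne'
  · unfold Sy
    rw [sum_comp', comp_sum']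
    simp only [kr_mul, ← mul_assoc, (hc _).1, kr_smul_left, kr_smul_right, smul_smul]
    rw [← Finset.sum_smul]
    push_cast
    rfl

theorem pi_ee : pi ∘ₗ kr ek 1 = pi ∘ₗ kr 1 ek := by
  unfold ee
  rw [kr_smul_left, kr_smul_right, LinearMap.comp_smul, LinearMap.comp_smul, pi_E]

theorem pi_ee_ee : pi ∘ₗ kr ek 1 = pi ∘ₗ (kr ak ak + kr lk lk) := by
  have h1 : pi ∘ₗ kr ek 1 = pi ∘ₗ kr ek ek := by
    have : kr ek ek = kr ek 1 ∘ₗ kr 1 ek := by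
      rw [kr_mul, mul_one, one_mul]
    rw [this, ← LinearMap.comp_assoc, pi_ee, LinearMap.comp_assoc, kr_mul, ee_mul_ee, mul_one]
  have h2 : pi ∘ₗ kr ak lk = 0 := by
    have : kr ak lk = kr ak 1 ∘ₗ kr 1 lk := by
      rw [kr_mul, mul_one, one_mul]
    rw [this, ← LinearMap.comp_assoc, pi_aa, LinearMap.comp_assoc, kr_mul, aa_mul_ll,
      kr_zero_right, LinearMap.comp_zero]
  have h3 : pi ∘ₗ kr lk ak = 0 := by
    have : kr lk ak = kr 1 ak ∘ₗ kr lk 1 := by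
      rw [kr_mul, mul_one, one_mul]
    rw [this, ← LinearMap.comp_assoc, ← pi_aa, LinearMap.comp_assoc, kr_mul, aa_mul_ll,
      kr_zero_left, LinearMap.comp_zero]
  have h4 : ek = ak + lk := by unfold ll; simp
  rw [h1, h4, kr_add_left, kr_add_right, kr_add_right]
  simp only [LinearMap.comp_add, h2, h3, add_zero, zero_add]

theorem rank_pi_ee (hk : 1 ≤ k) :
    (Module.finrank ℂ (LinearMap.range (pi ∘ₗ kr (E n (hat k)) 1)) : ℂ) =
      (n.choose (k + 1) : ℂ) ^ 2 + (n * n.choose k - n.choose (k + 1) : ℂ) ^ 2 := by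
  have h0 : LinearMap.range (pi ∘ₗ kr (E n (hat k)) 1) =
      LinearMap.range (pi ∘ₗ (kr ak ak + kr lk lk)) := by
    rw [← pi_ee_ee, ee, kr_smul_left, LinearMap.comp_smul, LinearMap.range_smul]
    exact inv_ne_zero card_perm_ne
  rw [h0]
  obtain ⟨s, hs, hs'⟩ := exists_s (n := n) hk
  have e1 : kr ak ak ∘ₗ kr lk lk = 0 := by rw [kr_mul, aa_mul_ll, kr_zero_left]
  have e2 : kr lk lk ∘ₗ kr ak ak = 0 := by rw [kr_mul, ll_mul_aa, kr_zero_left]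
  have e3 : kr ak ak ∘ₗ kr ak ak = kr ak ak := by rw [kr_mul, aa_mul_aa]
  have e4 : kr lk lk ∘ₗ kr lk lk = kr lk lk := by rw [kr_mul, ll_mul_ll]
  have e5 : kr ak ak ∘ₗ Sy (Option (Fin k)) n ∘ₗ kr lk lk = 0 := by
    unfold Sy
    rw [sum_comp', comp_sum']
    simp only [kr_mul, ← mul_assoc, aa_mul_U, smul_mul_assoc, aa_mul_ll, smul_zero, kr_zero_left]
    simp
  have := rank_idem (kr ak ak + kr lk lk) (by
      simp only [LinearMap.comp_add, LinearMap.add_comp, e1, e2, e3, e4, add_zero, zero_add]) pi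
    (((Fintype.card (Perm (Option (Fin k))) : ℂ)⁻¹ • kr ak ak + s⁻¹ • kr lk lk) ∘ₗ rho) (by
      rw [LinearMap.comp_assoc, ← LinearMap.comp_assoc _ pi, rho_pi]
      simp only [LinearMap.comp_add, LinearMap.add_comp, LinearMap.smul_comp, hs', e5, Sy_aa,
        LinearMap.comp_smul, e2, e3, smul_zero, smul_smul, inv_mul_cancel₀ hs,
        mul_inv_cancel₀ (card_perm_ne (ι := Option (Fin k))), one_smul, add_zero, zero_add])
  rw [this, map_add, trace_kr, trace_kr, ll, Matrix.trace_sub, trace_aa, trace_ee,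
    Fintype.card_option, Fintype.card_fin]
  ring

end rank2

section final

variable {k n : ℕ}

/-- minors indexed by tuples -/
noncomputable def tm (z : (Fin k → Fin n) × (Fin k → Fin n)) : MvPolynomial (Fin n × Fin n) ℂ :=
  Matrix.det (Matrix.of fun a b : Fin k => X (z.1 a, z.2 b))

theorem tm_eq (z : (Fin k → Fin n) × (Fin k → Fin n)) :
    tm z = ∑ σ : Perm (Fin k), sg σ • mono (z.1 ∘ σ, z.2) := by
  unfold tm
  rw [Matrix.det_apply']
  refine Finset.sum_congr rfl fun σ _ => ?_
  rw [MvPolynomial.smul_eq_C_mul]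
  simp [sg, mono]

/-- linear forms times minors -/
noncomputable def xm (z : (Option (Fin k) → Fin n) × (Option (Fin k) → Fin n)) :
    MvPolynomial (Fin n × Fin n) ℂ :=
  X (z.1 none, z.2 none) * tm (z.1 ∘ some, z.2 ∘ some)

theorem xm_eq (z : (Option (Fin k) → Fin n) × (Option (Fin k) → Fin n)) :
    xm z = ∑ σ : Perm (Fin k), sg (hat k σ) • mono (z.1 ∘ hat k σ, z.2) := by
  unfold xm
  rw [tm_eq, Finset.mul_sum]
  refine Finset.sum_congr rfl fun σ _ => ?_
  rw [mul_smul_comm, sg_hat]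
  congr 1
  unfold mono
  rw [Fintype.prod_option]
  rfl

theorem range_tm : LinearMap.range (pi ∘ₗ kr (E n (MonoidHom.id (Perm (Fin k)))) 1) =
    Submodule.span ℂ (Set.range (tm : (Fin k → Fin n) × (Fin k → Fin n) → _)) := by
  rw [← Fintype.range_linearCombination]
  congr 1
  refine LinearMap.ext fun f => ?_
  rw [LinearMap.comp_apply, pi_E_apply, Fintype.linearCombination_apply]
  simp only [tm_eq, MonoidHom.id_apply]

theorem range_xm : LinearMap.range (pi ∘ₗ kr (E n (hat k)) 1) =
    Submodule.span ℂ (Set.range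
      (xm : (Option (Fin k) → Fin n) × (Option (Fin k) → Fin n) → _)) := by
  rw [← Fintype.range_linearCombination]
  congr 1
  refine LinearMap.ext fun f => ?_
  rw [LinearMap.comp_apply, pi_E_apply, Fintype.linearCombination_apply]
  simp only [xm_eq]

theorem tm_not_inj (z : (Fin k → Fin n) × (Fin k → Fin n))
    (h : ¬ (Function.Injective z.1 ∧ Function.Injective z.2)) : tm z = 0 := by
  rw [not_and_or] at h
  unfold tm
  rcases h with h | h
  · simp only [Function.Injective, not_forall] at h
    obtain ⟨p, q, hpq, hne⟩ := h
    exact Matrix.det_zero_of_row_eq hne (by ext1 b; simp [hpq])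
  · simp only [Function.Injective, not_forall] at h
    obtain ⟨p, q, hpq, hne⟩ := h
    exact Matrix.det_zero_of_column_eq hne (by intro b; simp [hpq])

theorem exists_sort (i : Fin k → Fin n) (h : Function.Injective i) :
    ∃ (R : Finset (Fin n)) (hR : R.card = k) (σ : Perm (Fin k)),
      ∀ a, i a = (R.orderIsoOfFin hR (σ a) : Fin n) := by
  have hR : (Finset.univ.image i).card = k := by
    rw [Finset.card_image_of_injective _ h]; simp
  refine ⟨Finset.univ.image i, hR, Equiv.ofBijective
    (fun a => ((Finset.univ.image i).orderIsoOfFin hR).symm ⟨i a, by simp⟩) ?_, ?_⟩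
  · refine Finite.injective_iff_bijective.mp ?_
    intro a b hab
    have := (OrderIso.injective _) hab
    exact h (by simpa using this)
  · intro a
    simp

theorem tm_mem (z : (Fin k → Fin n) × (Fin k → Fin n)) :
    tm z ∈ Submodule.span ℂ {p | ∃ (R C : Finset (Fin n)) (hR : R.card = k) (hC : C.card = k),
        p = genericMinor k R C hR hC} := by
  by_cases h : Function.Injective z.1 ∧ Function.Injective z.2
  · obtain ⟨R, hR, σ, hσ⟩ := exists_sort z.1 h.1
    obtain ⟨C, hC, τ, hτ⟩ := exists_sort z.2 h.2
    have : tm z = (sg σ * sg τ) • genericMinor k R C hR hC := by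
      unfold tm genericMinor
      set M : Matrix (Fin k) (Fin k) (MvPolynomial (Fin n × Fin n) ℂ) :=
        Matrix.of fun a b : Fin k =>
          X ((R.orderIsoOfFin hR a : Fin n), (C.orderIsoOfFin hC b : Fin n)) with hM
      have h1 : (Matrix.of fun a b : Fin k =>
          (X (z.1 a, z.2 b) : MvPolynomial (Fin n × Fin n) ℂ)) =
          (M.submatrix σ id).submatrix id τ := by
        ext1 a b
        simp [hM, hσ, hτ]
      rw [h1, Matrix.det_permute', Matrix.det_permute, MvPolynomial.smul_eq_C_mul]
      simp [sg]
      ring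
    rw [this]
    exact Submodule.smul_mem _ _ (Submodule.subset_span ⟨R, C, hR, hC, rfl⟩)
  · rw [tm_not_inj z h]
    exact Submodule.zero_mem _

theorem span_tm : Submodule.span ℂ {p | ∃ (R C : Finset (Fin n)) (hR : R.card = k)
      (hC : C.card = k), p = genericMinor k R C hR hC} =
    Submodule.span ℂ (Set.range (tm : (Fin k → Fin n) × (Fin k → Fin n) → _)) := by
  apply le_antisymm
  · refine Submodule.span_mono ?_
    rintro _ ⟨R, C, hR, hC, rfl⟩
    exact ⟨(fun a => R.orderIsoOfFin hR a, fun a => C.orderIsoOfFin hC a), rfl⟩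
  · rw [Submodule.span_le]
    rintro _ ⟨z, rfl⟩
    exact tm_mem z

theorem span_xm : Submodule.span ℂ (Set.range (tm : (Fin k → Fin n) × (Fin k → Fin n) → _)) *
    homogeneousSubmodule (Fin n × Fin n) ℂ 1 =
    Submodule.span ℂ (Set.range
      (xm : (Option (Fin k) → Fin n) × (Option (Fin k) → Fin n) → _)) := by
  rw [MvPolynomial.homogeneousSubmodule_one_eq_span_X, Submodule.span_mul_span]
  congr 1
  ext p
  rw [Set.mem_mul]
  constructor
  · rintro ⟨_, ⟨z, rfl⟩, _, ⟨w, rfl⟩, rfl⟩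
    refine ⟨(fun o => o.elim w.1 z.1, fun o => o.elim w.2 z.2), ?_⟩
    rw [mul_comm]
    rfl
  · rintro ⟨z, rfl⟩
    exact ⟨_, ⟨(z.1 ∘ some, z.2 ∘ some), rfl⟩, _, ⟨(z.1 none, z.2 none), rfl⟩, mul_comm _ _⟩

theorem finrank_lin : Module.finrank ℂ (homogeneousSubmodule (Fin n × Fin n) ℂ 1) = n * n := by
  rw [MvPolynomial.homogeneousSubmodule_one_eq_span_X, finrank_span_eq_card]
  · simp
  · exact MvPolynomial.linearIndependent_X _ _

theorem rank_null_tensor {V W Z : Type*} [AddCommGroup V] [AddCommGroup W] [AddCommGroup Z]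
    [Module ℂ V] [Module ℂ W] [Module ℂ Z] [FiniteDimensional ℂ V] [FiniteDimensional ℂ W]
    (f : V ⊗[ℂ] W →ₗ[ℂ] Z) :
    Module.finrank ℂ (LinearMap.range f) + Module.finrank ℂ (LinearMap.ker f) =
      Module.finrank ℂ V * Module.finrank ℂ W := by
  rw [LinearMap.finrank_range_add_finrank_ker f, Module.finrank_tensorProduct]

end final

end SyzMinors

/-- For `1 ≤ κ ≤ n−1`, let `D` be the span of the `κ × κ` minors of the generic `n × n`
matrix inside `S_κ`, and let `μ : D ⊗ S_1 → S_{κ+1}` be the multiplication map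
(characterized by `μ(p ⊗ ℓ) = p·ℓ` on pure tensors). Then the kernel of `μ` — the space of
linear first syzygies of the ideal of `κ × κ` minors — has dimension
`(2κ(n+1)/(n−κ)) · C(n, κ+1)²`, i.e. `(n−κ) · dim ker μ = 2κ(n+1) · C(n, κ+1)²`. -/
theorem dim_linearSyzygies_minors (n κ : ℕ) (h1 : 1 ≤ κ) (h2 : κ ≤ n - 1)
    (D : Submodule ℂ (MvPolynomial (Fin n × Fin n) ℂ))
    (hD : D = Submodule.span ℂ
      {p | ∃ (R C : Finset (Fin n)) (hR : R.card = κ) (hC : C.card = κ),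
        p = genericMinor κ R C hR hC})
    (μ : ↥D ⊗[ℂ] ↥(homogeneousSubmodule (Fin n × Fin n) ℂ 1) →ₗ[ℂ]
         ↥(homogeneousSubmodule (Fin n × Fin n) ℂ (κ + 1)))
    (hμ : ∀ (p : ↥D) (ℓ : ↥(homogeneousSubmodule (Fin n × Fin n) ℂ 1)),
      ((μ (p ⊗ₜ[ℂ] ℓ) : MvPolynomial (Fin n × Fin n) ℂ)) =
        (p : MvPolynomial (Fin n × Fin n) ℂ) * (ℓ : MvPolynomial (Fin n × Fin n) ℂ)) :
    (n - κ) * Module.finrank ℂ ↥(LinearMap.ker μ) = 2 * κ * (n + 1) * n.choose (κ + 1) ^ 2 := by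
  have hDt := hD.trans SyzMinors.span_tm
  have hfD : Module.finrank ℂ D = n.choose κ ^ 2 := by
    rw [hDt, ← SyzMinors.range_tm, SyzMinors.rank_pi_aa, Fintype.card_fin]
  have hfinD : Module.Finite ℂ D := by
    rw [hDt, ← SyzMinors.range_tm]; infer_instance
  have hfin1 : Module.Finite ℂ (homogeneousSubmodule (Fin n × Fin n) ℂ 1) := by
    rw [MvPolynomial.homogeneousSubmodule_one_eq_span_X]
    exact FiniteDimensional.span_of_finite _ (Set.finite_range _)
  have hr : (LinearMap.range μ).map (homogeneousSubmodule (Fin n × Fin n) ℂ (κ + 1)).subtype =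
      LinearMap.range (SyzMinors.pi ∘ₗ SyzMinors.kr (SyzMinors.E n (SyzMinors.hat κ)) 1) := by
    rw [SyzMinors.range_xm, ← SyzMinors.span_xm, ← hDt]
    apply le_antisymm
    · rw [← LinearMap.range_comp]
      rintro _ ⟨t, rfl⟩
      induction t using TensorProduct.induction_on with
      | zero => simp
      | tmul p l =>
        rw [LinearMap.comp_apply, Submodule.subtype_apply, hμ]
        exact Submodule.mul_mem_mul p.2 l.2
      | add a b ha hb => rw [map_add]; exact Submodule.add_mem _ ha hb
    · rw [Submodule.mul_le]
      intro p hp l hl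
      exact ⟨μ (⟨p, hp⟩ ⊗ₜ ⟨l, hl⟩), ⟨_, rfl⟩, hμ _ _⟩
  have hrank : Module.finrank ℂ (LinearMap.range μ) = Module.finrank ℂ (LinearMap.range
      (SyzMinors.pi ∘ₗ SyzMinors.kr (SyzMinors.E n (SyzMinors.hat κ)) 1)) := by
    rw [← hr]
    exact (LinearEquiv.finrank_eq (Submodule.equivMapOfInjective _
      (Submodule.injective_subtype _) _))
  have hsum := SyzMinors.rank_null_tensor (V := D)
    (W := homogeneousSubmodule (Fin n × Fin n) ℂ 1)
    (Z := homogeneousSubmodule (Fin n × Fin n) ℂ (κ + 1)) μ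
  rw [hfD, SyzMinors.finrank_lin, hrank] at hsum
  have hR := SyzMinors.rank_pi_ee (n := n) h1
  have hc := Nat.choose_succ_right_eq n κ
  have hle : κ ≤ n := h2.trans (Nat.sub_le _ _)
  have hc' := congrArg (Nat.cast : ℕ → ℂ) hc
  have hs' := congrArg (Nat.cast : ℕ → ℂ) hsum
  push_cast [Nat.cast_sub hle] at hc' hs'
  rw [hR] at hs'
  have goal' : (((n - κ) * Module.finrank ℂ ↥(LinearMap.ker μ) : ℕ) : ℂ) =
      ((2 * κ * (n + 1) * n.choose (κ + 1) ^ 2 : ℕ) : ℂ) := by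
    push_cast [Nat.cast_sub hle]
    linear_combination ((n : ℂ) - κ) * hs' - 2 * (n : ℂ) * (n.choose (κ + 1) : ℂ) * hc'
  exact_mod_cast goal'
end

section
/- Let r, p, q ≥ 0 be integers with r+q+1 ≤ n and r+p+1 ≤ n. In S_{r+1} ⊗ Λ^{p+q}V, consider the element T = Σ (−1)^{i_1+⋯+i_q+j_1+⋯+j_p} M^{{1,…,r+q+1}∖I}_{{1,…,r+p+1}∖J} ⊗ (x_{1,j_1}∧⋯∧x_{1,j_p}∧x_{i_1,1}∧⋯∧x_{i_q,1}), where the sum is over all subsets I = {i_1 < ⋯ < i_q} ⊆ {1,…,r+q+1} and J = {j_1 < ⋯ < j_p} ⊆ {1,…,r+p+1}, and M^A_B denotes the determinant of the submatrix of (x_{i,j}) with rows A and columns B. Then T lies in the kernel of the Koszul boundary map ∂ : S_{r+1} ⊗ Λ^{p+q}V → S_{r+2} ⊗ Λ^{p+q−1}V, i.e. ∂(T) = 0; thus T is a cycle of the Koszul complex (it represents the highest weight syzygy of the linear strand of the resolution of the ideal of (r+1)×(r+1) minors). -/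
open MvPolynomial TensorProduct

set_option synthInstance.maxHeartbeats 1000000
set_option maxHeartbeats 1000000

/-- The variable `x_{a,b}` as an element of the space `V = S_1` of linear forms. -/
noncomputable def Xv {n : ℕ} (a b : Fin n) :
    ↥(homogeneousSubmodule (Fin n × Fin n) ℂ 1) :=
  ⟨X (a, b), (mem_homogeneousSubmodule 1 _).mpr (isHomogeneous_X ℂ (a, b))⟩

/-- The wedge `v_1 ∧ ⋯ ∧ v_m` as an element of the `m`-th exterior power `⋀[ℂ]^m M`. -/
noncomputable def wedge {M : Type*} [AddCommGroup M] [Module ℂ M] (m : ℕ) (v : Fin m → M) :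
    ↥(⋀[ℂ]^m M) :=
  ⟨ExteriorAlgebra.ιMulti ℂ m v, ExteriorAlgebra.ιMulti_range ℂ m ⟨v, rfl⟩⟩

/-- Removal of the `α`-th entry from a tuple `w : Fin k → β`. -/
def remove {k : ℕ} {β : Type*} (α : Fin k) (w : Fin k → β) : Fin (k - 1) → β :=
  fun t => if _h : (t : ℕ) < (α : ℕ) then w ⟨t, by have := t.isLt; have := α.isLt; omega⟩
    else w ⟨(t : ℕ) + 1, by have := t.isLt; have := α.isLt; omega⟩

/-- position relation -/
structure KRel {N p s : ℕ} (J : Fin (p+1) → Fin N) (t : Fin (p+1)) (Jc : Fin s → Fin N)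
    (K : Fin p → Fin N) (Kc : Fin (s+1) → Fin N) (k : Fin (s+1)) : Prop where
  h1 : ∀ i, J (t.succAbove i) = K i
  h2 : ∀ i, Kc (k.succAbove i) = Jc i
  h3 : Kc k = J t
  h4 : (t : ℕ) + k = (J t : ℕ)

lemma card_c {N p s : ℕ} (hN : N = p + s) (J : {x : Finset (Fin N) // x.card = p}) :
    (J.1ᶜ).card = s := by
  rw [Finset.card_compl, J.2, Fintype.card_fin]; omega

/-- sorted enumeration -/
noncomputable def en {N p : ℕ} (J : {x : Finset (Fin N) // x.card = p}) : Fin p → Fin N :=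
  J.1.orderEmbOfFin J.2

/-- sorted enumeration of the complement -/
noncomputable def enc {N p s : ℕ} (hN : N = p + s) (J : {x : Finset (Fin N) // x.card = p}) :
    Fin s → Fin N :=
  (J.1ᶜ).orderEmbOfFin (card_c hN J)

lemma en_mem {N p : ℕ} (J : {x : Finset (Fin N) // x.card = p}) (t) : en J t ∈ J.1 :=
  Finset.orderEmbOfFin_mem _ _ _

lemma enc_mem {N p s : ℕ} (hN : N = p + s) (J : {x : Finset (Fin N) // x.card = p}) (t) :
    enc hN J t ∉ J.1 := by
  exact Finset.mem_compl.mp (Finset.orderEmbOfFin_mem (J.1ᶜ) (card_c hN J) t)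

lemma exists_pos {α : Type*} [LinearOrder α] {p : ℕ} (J : Finset α) (h : J.card = p) {j : α}
    (hj : j ∈ J) : ∃ t, J.orderEmbOfFin h t = j := by
  have : j ∈ Set.range (J.orderEmbOfFin h) := by rw [Finset.range_orderEmbOfFin]; exact hj
  exact this

lemma pos_card {α : Type*} [LinearOrder α] {p : ℕ} (J : Finset α) (h : J.card = p) (t : Fin p) :
    (J.filter (· < J.orderEmbOfFin h t)).card = t := by
  have : J.filter (· < J.orderEmbOfFin h t) = (Finset.Iio t).map (J.orderEmbOfFin h).toEmbedding := by
    ext x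
    simp only [Finset.mem_filter, Finset.mem_map, Finset.mem_Iio]
    constructor
    · rintro ⟨hx, hlt⟩
      obtain ⟨i, rfl⟩ := exists_pos J h hx
      exact ⟨i, by simpa using hlt, rfl⟩
    · rintro ⟨i, hi, rfl⟩
      exact ⟨Finset.orderEmbOfFin_mem _ _ _, by simpa using hi⟩
  rw [this, Finset.card_map, Fin.card_Iio]

lemma krel {N p s : ℕ} (hN : N = p + 1 + s) (hN' : N = p + (s + 1))
    (J : {x : Finset (Fin N) // x.card = p + 1}) (K : {x : Finset (Fin N) // x.card = p})
    (t : Fin (p+1)) (k : Fin (s+1)) (hJ : J.1 = insert (en J t) K.1) (hk : enc hN' K k = en J t) :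
    KRel (en J) t (enc hN J) (en K) (enc hN' K) k := by
  have hnot : en J t ∉ K.1 := hk ▸ enc_mem hN' K k
  refine ⟨?_, ?_, hk, ?_⟩
  · intro i
    have : ((J.1.orderEmbOfFin J.2) ∘ t.succAbove) = K.1.orderEmbOfFin K.2 := by
      apply Finset.orderEmbOfFin_unique
      · intro x
        have h1 : en J (t.succAbove x) ∈ J.1 := en_mem _ _
        rw [hJ, Finset.mem_insert] at h1
        rcases h1 with h1 | h1
        · exact absurd ((J.1.orderEmbOfFin J.2).injective h1) (Fin.succAbove_ne _ _)
        · exact h1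
      · exact (J.1.orderEmbOfFin J.2).strictMono.comp (Fin.strictMono_succAbove t)
    exact congrFun this i
  · intro i
    have : ((K.1ᶜ.orderEmbOfFin (card_c hN' K)) ∘ k.succAbove)
        = J.1ᶜ.orderEmbOfFin (card_c hN J) := by
      apply Finset.orderEmbOfFin_unique
      · intro x
        have h1 : enc hN' K (k.succAbove x) ∉ K.1 := enc_mem _ _ _
        rw [Finset.mem_compl, hJ, Finset.mem_insert]
        rintro (h2 | h2)
        · rw [← hk] at h2
          exact absurd ((K.1ᶜ.orderEmbOfFin (card_c hN' K)).injective h2) (Fin.succAbove_ne _ _)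
        · exact h1 h2
      · exact (K.1ᶜ.orderEmbOfFin (card_c hN' K)).strictMono.comp (Fin.strictMono_succAbove k)
    exact congrFun this i
  · have e1 := pos_card J.1 J.2 t
    have e2 := pos_card K.1ᶜ (card_c hN' K) k
    change (J.1.filter (· < en J t)).card = _ at e1
    change (K.1ᶜ.filter (· < enc hN' K k)).card = _ at e2
    rw [hk] at e2
    rw [← e1, ← e2, ← Finset.card_union_of_disjoint]
    · rw [← Fin.card_Iio (en J t)]
      congr 1
      ext x
      simp only [Finset.mem_union, Finset.mem_filter, Finset.mem_compl, Finset.mem_Iio]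
      rw [hJ, Finset.mem_insert]
      constructor
      · tauto
      · intro h
        by_cases hx : x ∈ K.1 <;> tauto
    · rw [Finset.disjoint_left]
      intro x hx hx'
      simp only [Finset.mem_filter, Finset.mem_compl] at hx hx'
      have := hx.1
      rw [hJ, Finset.mem_insert] at this
      rcases this with h | h
      · exact absurd hx.2 (by rw [h]; exact lt_irrefl _)
      · exact hx'.1 h

/-- lower -/
noncomputable def lowr {N p : ℕ} (J : {x : Finset (Fin N) // x.card = p + 1}) (t : Fin (p+1)) :
    {x : Finset (Fin N) // x.card = p} :=
  ⟨J.1.erase (en J t), by rw [Finset.card_erase_of_mem (en_mem _ _), J.2]; rfl⟩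

lemma lowr_spec {N p : ℕ} (J : {x : Finset (Fin N) // x.card = p + 1}) (t : Fin (p+1)) :
    J.1 = insert (en J t) (lowr J t).1 := (Finset.insert_erase (en_mem J t)).symm

lemma lowr_ex {N p s : ℕ} (hN' : N = p + (s + 1))
    (J : {x : Finset (Fin N) // x.card = p + 1}) (t : Fin (p+1)) :
    ∃ k, enc hN' (lowr J t) k = en J t := by
  apply exists_pos
  simp [lowr]

/-- upper -/
noncomputable def uppr {N p s : ℕ} (hN' : N = p + (s + 1))
    (K : {x : Finset (Fin N) // x.card = p}) (k : Fin (s+1)) :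
    {x : Finset (Fin N) // x.card = p + 1} :=
  ⟨insert (enc hN' K k) K.1, by rw [Finset.card_insert_of_notMem (enc_mem _ _ _), K.2]⟩

lemma uppr_ex {N p s : ℕ} (hN' : N = p + (s + 1))
    (K : {x : Finset (Fin N) // x.card = p}) (k : Fin (s+1)) :
    ∃ t, en (uppr hN' K k) t = enc hN' K k := by
  apply exists_pos
  simp [uppr]

lemma en_inj {N p : ℕ} (J : {x : Finset (Fin N) // x.card = p}) : Function.Injective (en J) :=
  (J.1.orderEmbOfFin J.2).injective

lemma enc_inj {N p s : ℕ} (hN : N = p + s) (J : {x : Finset (Fin N) // x.card = p}) :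
    Function.Injective (enc hN J) :=
  (J.1ᶜ.orderEmbOfFin _).injective

lemma reindex {N p s : ℕ} (hN : N = p + 1 + s) (hN' : N = p + (s + 1)) {M : Type*}
    [AddCommMonoid M] (F : {x : Finset (Fin N) // x.card = p + 1} → Fin (p+1) → M)
    (G : {x : Finset (Fin N) // x.card = p} → Fin (s+1) → M)
    (h : ∀ J t K k, J.1 = insert (en J t) K.1 → enc hN' K k = en J t → F J t = G K k) :
    ∑ J, ∑ t, F J t = ∑ K, ∑ k, G K k := by
  rw [← Fintype.sum_prod_type', ← Fintype.sum_prod_type']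
  refine Finset.sum_bij' (fun x _ => (lowr x.1 x.2, (lowr_ex hN' x.1 x.2).choose))
    (fun x _ => (uppr hN' x.1 x.2, (uppr_ex hN' x.1 x.2).choose)) (by simp) (by simp) ?_ ?_ ?_
  · rintro ⟨J, t⟩ -
    have h1 := (lowr_ex hN' J t).choose_spec
    have h2 := (uppr_ex hN' (lowr J t) (lowr_ex hN' J t).choose).choose_spec
    have e : uppr hN' (lowr J t) (lowr_ex hN' J t).choose = J := by
      apply Subtype.ext
      change insert _ _ = _
      rw [h1]; exact (lowr_spec J t).symm
    apply Prod.ext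
    · exact e
    · apply en_inj J
      exact (congrArg (fun Z => en Z _) e.symm).trans (h2.trans h1)
  · rintro ⟨K, k⟩ -
    have h1 := (uppr_ex hN' K k).choose_spec
    have h2 := (lowr_ex hN' (uppr hN' K k) (uppr_ex hN' K k).choose).choose_spec
    have e : lowr (uppr hN' K k) (uppr_ex hN' K k).choose = K := by
      apply Subtype.ext
      change Finset.erase _ _ = _
      rw [h1]; exact Finset.erase_insert (enc_mem _ _ _)
    apply Prod.ext
    · exact e
    · apply enc_inj hN' K
      exact (congrArg (fun Z => enc hN' Z _) e.symm).trans (h2.trans h1)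
  · rintro ⟨J, t⟩ -
    exact h _ _ _ _ (lowr_spec J t) (lowr_ex hN' J t).choose_spec

lemma sum_spec {N p : ℕ} (J : {x : Finset (Fin N) // x.card = p + 1})
    (K : {x : Finset (Fin N) // x.card = p}) (j : Fin N) (hJ : J.1 = insert j K.1) (hj : j ∉ K.1) :
    ∑ i ∈ J.1, (i : ℕ) = (j : ℕ) + ∑ i ∈ K.1, (i : ℕ) := by
  rw [hJ, Finset.sum_insert hj]

lemma en_zero {N p : ℕ} [NeZero N] (J : {x : Finset (Fin N) // x.card = p + 1}) (h : 0 ∈ J.1) :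
    en J 0 = 0 := by
  obtain ⟨t, ht⟩ := exists_pos J.1 J.2 h
  have : en J 0 ≤ en J t := (J.1.orderEmbOfFin J.2).monotone (Fin.zero_le t)
  have ht' : en J t = 0 := ht
  rw [ht'] at this
  exact le_antisymm this (Fin.zero_le _)

lemma enc_zero {N p s : ℕ} [NeZero N] (hN : N = p + (s + 1))
    (J : {x : Finset (Fin N) // x.card = p}) (h : 0 ∉ J.1) :
    enc hN J 0 = 0 := 
  en_zero ⟨J.1ᶜ, card_c hN J⟩ (by simpa using h)

lemma reindex0 {N p s : ℕ} [NeZero N] (hN' : N = p + (s + 1)) {M : Type*}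
    [AddCommMonoid M] (F : {x : Finset (Fin N) // x.card = p + 1} → M)
    (G : {x : Finset (Fin N) // x.card = p} → M)
    (hF : ∀ J, 0 ∉ J.1 → F J = 0) (hG : ∀ K, 0 ∈ K.1 → G K = 0)
    (h : ∀ J K, en J 0 = 0 → J.1 = insert (en J 0) K.1 → enc hN' K 0 = en J 0 → F J = G K) :
    ∑ J, F J = ∑ K, G K := by
  have hz : ∀ J, F J ≠ 0 → 0 ∈ J.1 := fun J h => by by_contra hh; exact h (hF J hh)
  have hz' : ∀ K, G K ≠ 0 → 0 ∉ K.1 := fun J h hh => h (hG J hh)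
  have key : ∀ J : {x : Finset (Fin N) // x.card = p + 1}, 0 ∈ J.1 → 
      F J = G (lowr J 0) := by
    intro J hJ
    have h0 := en_zero J hJ
    refine h _ _ h0 (lowr_spec J 0) ?_
    rw [h0]
    apply enc_zero
    simp [lowr, h0]
  refine Finset.sum_bij_ne_zero (fun J _ _ => lowr J 0) (by simp) ?_ ?_ ?_
  · intro J _ hJ J' _ hJ' e
    apply Subtype.ext
    rw [lowr_spec J 0, lowr_spec J' 0, e, en_zero _ (hz J hJ), en_zero _ (hz J' hJ')]
  · intro K _ hK
    have h0 := hz' K hK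
    let J := uppr hN' K 0
    have hJ : 0 ∈ J.1 := by
      change _ ∈ insert _ _
      rw [enc_zero hN' K h0]; simp
    have e : lowr J 0 = K := by
      apply Subtype.ext
      change Finset.erase _ _ = _
      rw [en_zero J hJ]
      change Finset.erase (insert _ _) _ = _
      rw [enc_zero hN' K h0]
      exact Finset.erase_insert h0
    refine ⟨J, by simp, ?_, e⟩
    rw [key J hJ, e]; exact hK
  · intro J _ hJ
    exact key J (hz J hJ)

lemma neg_sign {a b c : ℕ} (k t : ℕ) (h : a = (t + k) + b) (hc : c = a + t) :
    (-1 : ℂ) ^ c = (-1) ^ b * (-1) ^ k := by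
  subst h; subst hc
  rw [show t + k + b + t = 2 * t + (b + k) by ring, pow_add, pow_mul]
  simp [pow_add]

lemma core {N p s : ℕ} (hN : N = p + 1 + s) (hN' : N = p + (s + 1)) {R E : Type*}
    [CommRing R] [Algebra ℂ R] [AddCommGroup E] [Module ℂ E]
    (Y : Fin s → Fin N → R) (y : Fin N → R) (w : (Fin p → Fin N) → E) :
    ∑ J : {x : Finset (Fin N) // x.card = p + 1}, ∑ t : Fin (p+1),
      ((-1 : ℂ) ^ ((∑ i ∈ J.1, (i : ℕ)) + t)) •
        ((Matrix.det (Matrix.of fun a b => Y a (enc hN J b)) * y (en J t)) ⊗ₜ[ℂ]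
          w (fun i => en J (t.succAbove i))) =
    ∑ K : {x : Finset (Fin N) // x.card = p}, ((-1 : ℂ) ^ (∑ i ∈ K.1, (i : ℕ))) •
      (Matrix.det (Matrix.of fun a b =>
        (Fin.cons y Y : Fin (s+1) → Fin N → R) a (enc hN' K b)) ⊗ₜ[ℂ] w (en K)) := by
  have : ∀ K : {x : Finset (Fin N) // x.card = p}, ((-1 : ℂ) ^ (∑ i ∈ K.1, (i : ℕ))) •
      (Matrix.det (Matrix.of fun a b =>
        (Fin.cons y Y : Fin (s+1) → Fin N → R) a (enc hN' K b)) ⊗ₜ[ℂ] w (en K)) =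
      ∑ k : Fin (s+1), ((-1 : ℂ) ^ (∑ i ∈ K.1, (i : ℕ)) * (-1) ^ (k : ℕ)) •
        ((Matrix.det (Matrix.of fun a b => Y a (enc hN' K (k.succAbove b))) * y (enc hN' K k))
          ⊗ₜ[ℂ] w (en K)) := by
    intro K
    rw [Matrix.det_succ_row_zero, TensorProduct.sum_tmul, Finset.smul_sum]
    refine Finset.sum_congr rfl fun k _ => ?_
    rw [mul_smul]
    congr 1
    rw [TensorProduct.smul_tmul']
    congr 1
    rw [Algebra.smul_def]
    simp only [Matrix.of_apply, Fin.cons_zero, map_pow, map_neg, map_one]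
    rw [mul_assoc]
    congr 1
    rw [mul_comm]
    congr 1
  simp_rw [this]
  apply reindex hN hN'
  intro J t K k hJ hk
  obtain ⟨h1, h2, h3, h4⟩ := krel hN hN' J K t k hJ hk
  have hs := sum_spec J K _ hJ (hk ▸ enc_mem hN' K k)
  rw [← h4] at hs
  rw [neg_sign k t hs rfl, h3]
  simp_rw [h1, h2]

lemma core' {N p s : ℕ} (hN : N = p + 1 + s) (hN' : N = p + (s + 1)) {R E ι : Type*}
    [CommRing R] [Algebra ℂ R] [AddCommGroup E] [Module ℂ E]
    (x : ι → Fin N → R) (i0 : ι) (f : Fin s → ι) (w : (Fin p → Fin N) → E) :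
    ∑ J : {x : Finset (Fin N) // x.card = p + 1}, ∑ t : Fin (p+1),
      ((-1 : ℂ) ^ ((∑ i ∈ J.1, (i : ℕ)) + t)) •
        ((Matrix.det (Matrix.of fun a b => x (f a) (enc hN J b)) * x i0 (en J t)) ⊗ₜ[ℂ]
          w (fun i => en J (t.succAbove i))) =
    ∑ K : {x : Finset (Fin N) // x.card = p}, ((-1 : ℂ) ^ (∑ i ∈ K.1, (i : ℕ))) •
      (Matrix.det (Matrix.of fun a b =>
        x ((Fin.cons i0 f : Fin (s+1) → ι) a) (enc hN' K b)) ⊗ₜ[ℂ] w (en K)) := by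
  rw [core hN hN' (fun a => x (f a)) (x i0) w]
  have : ∀ a, (Fin.cons (x i0) (fun a => x (f a)) : Fin (s+1) → Fin N → R) a
      = x ((Fin.cons i0 f : Fin (s+1) → ι) a) := by
    intro a; refine Fin.cases ?_ (fun i => ?_) a <;> simp
  simp_rw [this]

lemma det_side_zero {N q r : ℕ} [NeZero N] (hN : N = q + (r + 1)) {R : Type*} [CommRing R]
    (y : Fin N → Fin (r+1+1) → R) (I : {x : Finset (Fin N) // x.card = q}) (h : 0 ∉ I.1) :
    Matrix.det (Matrix.of fun a b =>
        y ((Fin.cons 0 (enc hN I) : Fin (r+1+1) → Fin N) a) b) = 0 := by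
  apply Matrix.det_zero_of_row_eq (i := 0) (j := Fin.succ 0) (Fin.succ_ne_zero 0).symm
  funext b
  simp only [Matrix.of_apply, Fin.cons_zero, Fin.cons_succ]
  rw [enc_zero hN I h]

lemma side {N q r : ℕ} [NeZero N] (hN : N = q + 1 + (r + 1)) (hN' : N = q + (r + 1 + 1))
    {R E : Type*} [CommRing R] [Algebra ℂ R] [AddCommGroup E] [Module ℂ E]
    (y : Fin N → Fin (r+1+1) → R) (w : (Fin (q+1) → Fin N) → E)
    (hw : ∀ g : Fin q → Fin N, ∀ i, g i = 0 → w (Fin.cons 0 g) = 0) :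
    ∑ I : {x : Finset (Fin N) // x.card = q + 1}, ((-1 : ℂ) ^ (∑ i ∈ I.1, (i : ℕ))) •
      (Matrix.det (Matrix.of fun a b =>
        y ((Fin.cons 0 (enc hN I) : Fin (r+1+1) → Fin N) a) b) ⊗ₜ[ℂ] w (en I)) =
    ∑ I : {x : Finset (Fin N) // x.card = q}, ((-1 : ℂ) ^ (∑ i ∈ I.1, (i : ℕ))) •
      (Matrix.det (Matrix.of fun a b => y (enc hN' I a) b) ⊗ₜ[ℂ] w (Fin.cons 0 (en I))) := by
  apply reindex0 hN'
  · intro J hJ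
    rw [det_side_zero hN y J hJ, TensorProduct.zero_tmul, smul_zero]
  · intro K hK
    obtain ⟨i, hi⟩ := exists_pos K.1 K.2 hK
    rw [hw (en K) i hi, TensorProduct.tmul_zero, smul_zero]
  · intro J K h0 hJ hk
    obtain ⟨h1, h2, h3, h4⟩ := krel hN hN' J K 0 0 hJ hk
    have hs := sum_spec J K _ hJ (hk ▸ enc_mem hN' K 0)
    rw [h0] at hs
    have e1 : (Fin.cons 0 (enc hN J) : Fin (r+1+1) → Fin N) = enc hN' K := by
      funext a
      refine Fin.cases ?_ (fun i => ?_) a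
      · simp [h3, h0]
      · rw [Fin.cons_succ, ← h2, Fin.succAbove_zero]
    have e2 : en J = (Fin.cons 0 (en K) : Fin (q+1) → Fin N) := by
      funext a
      refine Fin.cases ?_ (fun i => ?_) a
      · simp [h0]
      · rw [Fin.cons_succ, ← h1, Fin.succAbove_zero]
    rw [e1, e2, hs]
    simp

section EA
variable {V : Type*} [AddCommGroup V] [Module ℂ V]

local notation "mu" => ExteriorAlgebra.ιMulti ℂ

lemma mu_append {p q : ℕ} (u : Fin p → V) (v : Fin q → V) :
    mu (p+q) (Fin.append u v) = mu p u * mu q v := by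
  simp only [ExteriorAlgebra.ιMulti_apply]
  rw [← List.prod_append, ← List.ofFn_fin_append]
  congr 2
  funext i
  refine Fin.addCases (fun i => ?_) (fun i => ?_) i <;> simp

lemma mu_cons {p : ℕ} (z : V) (u : Fin p → V) :
    mu (p+1) (Fin.cons z u) = ExteriorAlgebra.ι ℂ z * mu p u := by
  rw [ExteriorAlgebra.ιMulti_apply, ExteriorAlgebra.ιMulti_apply, List.ofFn_succ, List.prod_cons]
  simp only [Fin.cons_zero, Fin.cons_succ]

lemma mu_remove {k : ℕ} (α : Fin k) (w : Fin k → V) :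
    mu (k-1) (remove α w) = ((List.ofFn fun i => ExteriorAlgebra.ι ℂ (w i)).eraseIdx α).prod := by
  rw [ExteriorAlgebra.ιMulti_apply]
  congr 1
  apply List.ext_getElem
  · simp [List.length_eraseIdx]
  · intro i h1 h2
    rw [List.getElem_eraseIdx]
    simp only [List.getElem_ofFn, remove]
    split_ifs <;> rfl

lemma mu_remove_left {p q : ℕ} (t : Fin p) (u : Fin p → V) (v : Fin q → V) :
    mu (p+q-1) (remove (Fin.castAdd q t) (Fin.append u v)) = mu (p-1) (remove t u) * mu q v := by
  rw [mu_remove, mu_remove, ExteriorAlgebra.ιMulti_apply, ← List.prod_append]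
  have : (fun i => ExteriorAlgebra.ι ℂ (Fin.append u v i)) =
      Fin.append (fun i => ExteriorAlgebra.ι ℂ (u i)) (fun i => ExteriorAlgebra.ι ℂ (v i)) := by
    funext i
    refine Fin.addCases (fun i => ?_) (fun i => ?_) i <;> simp
  rw [this, List.ofFn_fin_append, List.eraseIdx_append_of_lt_length]
  · rfl
  · simp

lemma mu_remove_right {p q : ℕ} (t : Fin q) (u : Fin p → V) (v : Fin q → V) :
    mu (p+q-1) (remove (Fin.natAdd p t) (Fin.append u v)) = mu p u * mu (q-1) (remove t v) := by
  rw [mu_remove, mu_remove, ExteriorAlgebra.ιMulti_apply, ← List.prod_append]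
  have : (fun i => ExteriorAlgebra.ι ℂ (Fin.append u v i)) =
      Fin.append (fun i => ExteriorAlgebra.ι ℂ (u i)) (fun i => ExteriorAlgebra.ι ℂ (v i)) := by
    funext i
    refine Fin.addCases (fun i => ?_) (fun i => ?_) i <;> simp
  rw [this, List.ofFn_fin_append, List.eraseIdx_append_of_length_le]
  · simp
  · simp

lemma mu_comm {p : ℕ} (z : V) (u : Fin p → V) :
    mu p u * ExteriorAlgebra.ι ℂ z = ((-1 : ℂ) ^ p) • (ExteriorAlgebra.ι ℂ z * mu p u) := by
  induction p with
  | zero => simp [ExteriorAlgebra.ιMulti_apply]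
  | succ p ih =>
    obtain ⟨a, u, rfl⟩ : ∃ a u', u = Fin.cons a u' := ⟨u 0, Fin.tail u, (Fin.cons_self_tail u).symm⟩
    have h : ExteriorAlgebra.ι ℂ a * ExteriorAlgebra.ι ℂ z
        = - (ExteriorAlgebra.ι ℂ z * ExteriorAlgebra.ι ℂ a) :=
      eq_neg_of_add_eq_zero_left (ExteriorAlgebra.ι_add_mul_swap a z)
    rw [mu_cons, mul_assoc, ih, mul_smul_comm, ← mul_assoc, h, pow_succ, mul_smul]
    simp [mul_assoc]

lemma mu_zero1 {p q : ℕ} (u : Fin p → V) (v : Fin q → V) (z : V) (i) (h : u i = z) :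
    ExteriorAlgebra.ι ℂ z * mu p u * mu q v = 0 := by
  rw [← mu_cons, AlternatingMap.map_eq_zero_of_eq (mu (p+1)) (Fin.cons z u) (i := 0) (j := i.succ)
    (by simp [h]) (Fin.succ_ne_zero i).symm, zero_mul]

lemma mu_zero2 {p q : ℕ} (u : Fin p → V) (v : Fin q → V) (z : V) (i) (h : v i = z) :
    ExteriorAlgebra.ι ℂ z * mu p u * mu q v = 0 := by
  have h1 := mu_comm z u
  have h2 : ExteriorAlgebra.ι ℂ z * mu p u = ((-1 : ℂ) ^ p) • (mu p u * ExteriorAlgebra.ι ℂ z) := by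
    rw [h1, smul_smul, ← mul_pow]; simp
  rw [h2, smul_mul_assoc, mul_assoc, ← mu_cons,
    AlternatingMap.map_eq_zero_of_eq (mu (q+1)) (Fin.cons z v) (i := 0) (j := i.succ)
    (by simp [h]) (Fin.succ_ne_zero i).symm, mul_zero, smul_zero]

lemma comp_cons {N q : ℕ} (v : Fin N → V) (a) (g : Fin q → Fin N) :
    (fun i => v ((Fin.cons a g : Fin (q+1) → Fin N) i)) = Fin.cons (v a) (fun i => v (g i)) := by
  funext i; refine Fin.cases ?_ (fun i => ?_) i <;> simp

/-- the common value -/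
noncomputable def ZZ {N N' r p q : ℕ} (hN : N = p + (r + 1 + 1))
    (hN' : N' = q + (r + 1 + 1)) {R : Type*} [CommRing R] [Algebra ℂ R]
    (x : Fin N' → Fin N → R) (u : Fin N → V) (v : Fin N' → V) (z : V) :
    R ⊗[ℂ] ExteriorAlgebra ℂ V :=
  ∑ I : {x : Finset (Fin N') // x.card = q}, ∑ J : {x : Finset (Fin N) // x.card = p},
    ((-1 : ℂ) ^ (∑ i ∈ I.1, (i : ℕ)) * (-1 : ℂ) ^ (∑ i ∈ J.1, (i : ℕ))) •
      (Matrix.det (Matrix.of fun a b => x (enc hN' I a) (enc hN J b)) ⊗ₜ[ℂ]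
        (ExteriorAlgebra.ι ℂ z * mu p (fun i => u (en J i)) * mu q (fun i => v (en I i))))

/-- first half of the boundary -/
noncomputable def AA {N N' s p q : ℕ} [NeZero N'] (hN : N = p + s)
    (hN' : N' = q + s) {R : Type*} [CommRing R] [Algebra ℂ R]
    (x : Fin N' → Fin N → R) (u : Fin N → V) (v : Fin N' → V) :
    R ⊗[ℂ] ExteriorAlgebra ℂ V :=
  ∑ I : {x : Finset (Fin N') // x.card = q}, ∑ J : {x : Finset (Fin N) // x.card = p},
    ((-1 : ℂ) ^ (∑ i ∈ I.1, (i : ℕ)) * (-1 : ℂ) ^ (∑ i ∈ J.1, (i : ℕ))) • ∑ t : Fin p,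
      ((-1 : ℂ) ^ (t : ℕ)) •
      ((Matrix.det (Matrix.of fun a b => x (enc hN' I a) (enc hN J b)) * x 0 (en J t)) ⊗ₜ[ℂ]
        (mu (p-1) (remove t fun i => u (en J i)) * mu q (fun i => v (en I i))))

/-- second half of the boundary -/
noncomputable def BB {N N' s p q : ℕ} [NeZero N] (hN : N = p + s)
    (hN' : N' = q + s) {R : Type*} [CommRing R] [Algebra ℂ R]
    (x : Fin N' → Fin N → R) (u : Fin N → V) (v : Fin N' → V) :
    R ⊗[ℂ] ExteriorAlgebra ℂ V :=
  ∑ I : {x : Finset (Fin N') // x.card = q}, ∑ J : {x : Finset (Fin N) // x.card = p},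
    ((-1 : ℂ) ^ (∑ i ∈ I.1, (i : ℕ)) * (-1 : ℂ) ^ (∑ i ∈ J.1, (i : ℕ))) • ∑ t : Fin q,
      ((-1 : ℂ) ^ (p + t : ℕ)) •
      ((Matrix.det (Matrix.of fun a b => x (enc hN' I a) (enc hN J b)) * x (en I t) 0) ⊗ₜ[ℂ]
        (mu p (fun i => u (en J i)) * mu (q-1) (remove t fun i => v (en I i))))

lemma remove_succ {p N : ℕ} (t : Fin (p+1)) (u : Fin N → V) (g : Fin (p+1) → Fin N) :
    (remove t fun i => u (g i)) = fun i : Fin p => u (g (t.succAbove i)) := by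
  funext i
  simp only [remove, Fin.succAbove, Fin.lt_def, Fin.val_castSucc]
  split_ifs <;> rfl

lemma AA_eq {N N' s p q : ℕ} [NeZero N'] (hN : N = p + 1 + s) (hM : N = p + (s + 1))
    (hN' : N' = q + s) {R : Type*} [CommRing R] [Algebra ℂ R]
    (x : Fin N' → Fin N → R) (u : Fin N → V) (v : Fin N' → V) :
    AA hN hN' x u v =
    ∑ J : {x : Finset (Fin N) // x.card = p}, ((-1 : ℂ) ^ (∑ i ∈ J.1, (i : ℕ))) •
    ∑ I : {x : Finset (Fin N') // x.card = q}, ((-1 : ℂ) ^ (∑ i ∈ I.1, (i : ℕ))) •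
      ((Matrix.det (Matrix.of fun a b =>
        x ((Fin.cons 0 (enc hN' I) : Fin (s+1) → Fin N') a) (enc hM J b))) ⊗ₜ[ℂ]
        (mu p (fun i => u (en J i)) * mu q (fun i => v (en I i)))) := by
  simp_rw [Finset.smul_sum]
  rw [Finset.sum_comm, AA]
  refine Finset.sum_congr rfl fun I _ => ?_
  have h := core' hN hM x 0 (enc hN' I) (fun g => mu p (fun i => u (g i)) * mu q (fun i => v (en I i)))
  have h' := congrArg (fun e => ((-1 : ℂ) ^ (∑ i ∈ I.1, (i : ℕ))) • e) h
  simp only [Finset.smul_sum] at h'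
  refine (Eq.trans ?_ h').trans (Finset.sum_congr rfl fun K _ => smul_comm _ _ _)
  refine Finset.sum_congr rfl fun J _ => ?_
  rw [Finset.smul_sum]
  refine Finset.sum_congr rfl fun t _ => ?_
  rw [remove_succ, pow_add, smul_smul, smul_smul, mul_assoc]
  rfl

lemma BB_eq {N N' s p q : ℕ} [NeZero N] (hN : N = p + s) (hN' : N' = q + 1 + s)
    (hM : N' = q + (s + 1)) {R : Type*} [CommRing R] [Algebra ℂ R]
    (x : Fin N' → Fin N → R) (u : Fin N → V) (v : Fin N' → V) :
    BB hN hN' x u v = ((-1 : ℂ) ^ p) •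
    ∑ I : {x : Finset (Fin N') // x.card = q}, ((-1 : ℂ) ^ (∑ i ∈ I.1, (i : ℕ))) •
    ∑ J : {x : Finset (Fin N) // x.card = p}, ((-1 : ℂ) ^ (∑ i ∈ J.1, (i : ℕ))) •
      ((Matrix.det (Matrix.of fun a b =>
        x (enc hM I b) ((Fin.cons 0 (enc hN J) : Fin (s+1) → Fin N) a))) ⊗ₜ[ℂ]
        (mu p (fun i => u (en J i)) * mu q (fun i => v (en I i)))) := by
  simp_rw [Finset.smul_sum]
  rw [Finset.sum_comm, BB, Finset.sum_comm]
  refine Finset.sum_congr rfl fun J _ => ?_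
  have h := core' hN' hM (fun a b => x b a) 0 (enc hN J)
    (fun g => mu p (fun i => u (en J i)) * mu q (fun i => v (g i)))
  have h' := congrArg (fun e => ((-1 : ℂ) ^ p) • ((-1 : ℂ) ^ (∑ i ∈ J.1, (i : ℕ))) • e) h
  simp only [Finset.smul_sum] at h'
  refine (Eq.trans ?_ h').trans
    (Finset.sum_congr rfl fun K _ => congrArg (((-1 : ℂ) ^ p) • ·) (smul_comm _ _ _))
  refine Finset.sum_congr rfl fun I _ => ?_
  rw [Finset.smul_sum]
  refine Finset.sum_congr rfl fun t _ => ?_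
  rw [remove_succ, ← Matrix.det_transpose]
  simp only [smul_smul]
  congr 1
  ring

lemma AA_zero {N N' r p : ℕ} [NeZero N'] (hN : N = p + 1 + (r+1))
    (hN' : N' = 0 + (r+1)) {R : Type*} [CommRing R] [Algebra ℂ R]
    (x : Fin N' → Fin N → R) (u : Fin N → V) (v : Fin N' → V) :
    AA hN hN' x u v = 0 := by
  rw [AA_eq hN (by omega)]
  refine Finset.sum_eq_zero fun J _ => ?_
  refine (congrArg (_ • ·) (Finset.sum_eq_zero fun I _ => ?_)).trans (smul_zero _)
  rw [det_side_zero hN' (fun i b => x i (enc _ J b)) I, TensorProduct.zero_tmul, smul_zero]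
  rw [Finset.card_eq_zero.mp I.2]; simp

lemma BB_zero {N N' r q : ℕ} [NeZero N] (hN : N = 0 + (r+1))
    (hN' : N' = q + 1 + (r+1)) {R : Type*} [CommRing R] [Algebra ℂ R]
    (x : Fin N' → Fin N → R) (u : Fin N → V) (v : Fin N' → V) :
    BB hN hN' x u v = 0 := by
  rw [BB_eq hN hN' (by omega), Finset.sum_eq_zero, smul_zero]
  intro I _
  refine (congrArg (_ • ·) (Finset.sum_eq_zero fun J _ => ?_)).trans (smul_zero _)
  rw [det_side_zero hN (fun i b => x (enc _ I b) i) J, TensorProduct.zero_tmul, smul_zero]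
  rw [Finset.card_eq_zero.mp J.2]; simp

lemma AA_main {N N' r p q : ℕ} [NeZero N'] (hN : N = p + 1 + (r+1)) (hM : N = p + (r + 1 + 1))
    (hN' : N' = q + 1 + (r+1)) (hM' : N' = q + (r + 1 + 1))
    {R : Type*} [CommRing R] [Algebra ℂ R]
    (x : Fin N' → Fin N → R) (u : Fin N → V) (v : Fin N' → V) (z : V) (hv : v 0 = z) :
    AA hN hN' x u v = ((-1 : ℂ) ^ p) • ZZ hM hM' x u v z := by
  rw [AA_eq hN hM, ZZ]
  simp_rw [Finset.smul_sum]
  rw [Finset.sum_comm, Finset.sum_comm (s := Finset.univ (α := {x : Finset (Fin N') // x.card = q})),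
    Finset.sum_comm]
  refine Finset.sum_congr rfl fun J _ => ?_
  have hc : ∀ g : Fin q → Fin N',
      mu p (fun i => u (en J i)) * mu (q+1) (fun i => v ((Fin.cons 0 g : Fin (q+1) → Fin N') i))
      = ((-1 : ℂ) ^ p) • (ExteriorAlgebra.ι ℂ z * mu p (fun i => u (en J i)) *
        mu q (fun i => v (g i))) := by
    intro g
    rw [comp_cons, mu_cons, hv, ← mul_assoc, mu_comm, smul_mul_assoc]
  rw [← Finset.smul_sum, side hN' hM' (fun i b => x i (enc hM J b))
    (fun g => mu p (fun i => u (en J i)) * mu (q+1) (fun i => v (g i)))]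
  · rw [Finset.smul_sum]
    refine Finset.sum_congr rfl fun I _ => ?_
    rw [hc, TensorProduct.tmul_smul]
    simp only [smul_smul]
    congr 1
    ring
  · intro g i hi
    rw [hc, mu_zero2 _ _ z i (by rw [hi, hv]), smul_zero]

lemma BB_main {N N' r p q : ℕ} [NeZero N] (hN : N = p + 1 + (r+1)) (hM : N = p + (r + 1 + 1))
    (hN' : N' = q + 1 + (r+1)) (hM' : N' = q + (r + 1 + 1))
    {R : Type*} [CommRing R] [Algebra ℂ R]
    (x : Fin N' → Fin N → R) (u : Fin N → V) (v : Fin N' → V) (z : V) (hu : u 0 = z) :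
    BB hN hN' x u v = ((-1 : ℂ) ^ (p+1)) • ZZ hM hM' x u v z := by
  rw [BB_eq hN hN' hM', ZZ]
  congr 1
  refine Finset.sum_congr rfl fun I _ => ?_
  have hc : ∀ g : Fin p → Fin N,
      mu (p+1) (fun i => u ((Fin.cons 0 g : Fin (p+1) → Fin N) i)) * mu q (fun i => v (en I i))
      = ExteriorAlgebra.ι ℂ z * mu p (fun i => u (g i)) * mu q (fun i => v (en I i)) := by
    intro g
    rw [comp_cons, mu_cons, hu]
  rw [side hN hM (fun i b => x (enc hM' I b) i)
    (fun g => mu (p+1) (fun i => u (g i)) * mu q (fun i => v (en I i)))]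
  · rw [Finset.smul_sum]
    refine Finset.sum_congr rfl fun J _ => ?_
    rw [hc, smul_smul, ← Matrix.det_transpose]
    rfl
  · intro g i hi
    rw [hc, mu_zero1 _ _ z i (by rw [hi, hu])]

lemma AB {N N' r p q : ℕ} [NeZero N] [NeZero N'] (hN : N = p + (r+1))
    (hN' : N' = q + (r+1)) {R : Type*} [CommRing R] [Algebra ℂ R]
    (x : Fin N' → Fin N → R) (u : Fin N → V) (v : Fin N' → V) (h : u 0 = v 0) :
    AA hN hN' x u v + BB hN hN' x u v = 0 := by
  rcases p with _ | p <;> rcases q with _ | q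
  · simp [AA, BB]
  · rw [BB_zero]; simp [AA]
  · rw [AA_zero]; simp [BB]
  · rw [AA_main hN (by omega) hN' (by omega) x u v _ rfl,
      BB_main hN (by omega) hN' (by omega) x u v _ h, ← add_smul, pow_succ]
    simp

lemma boundary {R : Type*} [CommRing R] [Algebra ℂ R] {p q : ℕ} (u : Fin p → V) (v : Fin q → V)
    (c : V → R) (f : R) :
    LinearMap.lTensor R (Submodule.subtype (⋀[ℂ]^(p+q-1) V))
      (∑ α : Fin (p+q), ((-1 : ℂ) ^ (α : ℕ)) •
        ((f * c (Fin.append u v α)) ⊗ₜ[ℂ] wedge (p+q-1) (remove α (Fin.append u v)))) =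
    ∑ t : Fin p, ((-1 : ℂ) ^ (t : ℕ)) • ((f * c (u t)) ⊗ₜ[ℂ] (mu (p-1) (remove t u) * mu q v)) +
    ∑ t : Fin q, ((-1 : ℂ) ^ (p + t : ℕ)) •
      ((f * c (v t)) ⊗ₜ[ℂ] (mu p u * mu (q-1) (remove t v))) := by
  rw [map_sum, Fin.sum_univ_add]
  congr 1
  · refine Finset.sum_congr rfl fun t _ => ?_
    rw [map_smul, LinearMap.lTensor_tmul, Fin.append_left, ← mu_remove_left]
    rfl
  · refine Finset.sum_congr rfl fun t _ => ?_
    rw [map_smul, LinearMap.lTensor_tmul, Fin.append_right, ← mu_remove_right]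
    rfl

end EA

lemma order_map {N n k : ℕ} (h : N ≤ n) (A : Finset (Fin N)) (hA : A.card = k)
    (hA' : (A.map (Fin.castLEEmb h)).card = k) (a : Fin k) :
    ((A.map (Fin.castLEEmb h)).orderIsoOfFin hA' a : Fin n) =
      Fin.castLE h (A.orderEmbOfFin hA a) := by
  have : (fun a => Fin.castLE h (A.orderEmbOfFin hA a)) =
      (A.map (Fin.castLEEmb h)).orderEmbOfFin hA' := by
    apply Finset.orderEmbOfFin_unique
    · intro x
      rw [Finset.mem_map]
      exact ⟨_, Finset.orderEmbOfFin_mem A hA x, rfl⟩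
    · exact (Fin.strictMono_castLE h).comp (A.orderEmbOfFin hA).strictMono
  exact (congrFun this a).symm

lemma sign_split {N N' p q : ℕ} (I : {s : Finset (Fin N') // s.card = q})
    (J : {s : Finset (Fin N) // s.card = p}) :
    (-1 : ℂ) ^ ((∑ i ∈ I.1, ((i : ℕ) + 1)) + ∑ j ∈ J.1, ((j : ℕ) + 1)) =
    (-1 : ℂ) ^ (q + p) * ((-1 : ℂ) ^ (∑ i ∈ I.1, (i : ℕ)) * (-1 : ℂ) ^ (∑ i ∈ J.1, (i : ℕ))) := by
  rw [Finset.sum_add_distrib, Finset.sum_add_distrib]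
  simp only [Finset.sum_const, I.2, J.2, smul_eq_mul, mul_one, pow_add]
  ring

/-- Let `r, p, q ≥ 0` with `r+q+1 ≤ n` and `r+p+1 ≤ n`, and let `∂` be the Koszul boundary
map (characterized on pure tensors against wedges).  The element
`T = Σ_{I,J} (−1)^{Σ I + Σ J} M^{{1,…,r+q+1}∖I}_{{1,…,r+p+1}∖J} ⊗
 (x_{1,j_1} ∧ ⋯ ∧ x_{1,j_p} ∧ x_{i_1,1} ∧ ⋯ ∧ x_{i_q,1})`,
summed over `I = {i_1<⋯<i_q} ⊆ {1,…,r+q+1}` and `J = {j_1<⋯<j_p} ⊆ {1,…,r+p+1}`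
(signs use the 1-based values of the indices), satisfies `∂ T = 0`: it is a cycle of the
Koszul complex, the highest weight syzygy of the linear strand of the minimal free
resolution of the ideal of `(r+1) × (r+1)` minors. -/
theorem koszul_cycle_minors (n r p q : ℕ) (hq : r + q + 1 ≤ n) (hp : r + p + 1 ≤ n)
    (δ : MvPolynomial (Fin n × Fin n) ℂ ⊗[ℂ]
           ↥(⋀[ℂ]^(p+q) ↥(homogeneousSubmodule (Fin n × Fin n) ℂ 1)) →ₗ[ℂ]
         MvPolynomial (Fin n × Fin n) ℂ ⊗[ℂ]
           ↥(⋀[ℂ]^(p+q-1) ↥(homogeneousSubmodule (Fin n × Fin n) ℂ 1)))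
    (hδ : ∀ (f : MvPolynomial (Fin n × Fin n) ℂ)
        (w : Fin (p+q) → ↥(homogeneousSubmodule (Fin n × Fin n) ℂ 1)),
      δ (f ⊗ₜ[ℂ] wedge (p+q) w) =
        ∑ α : Fin (p+q), ((-1 : ℂ) ^ (α : ℕ)) •
          ((f * ((w α : MvPolynomial (Fin n × Fin n) ℂ))) ⊗ₜ[ℂ] wedge (p+q-1) (remove α w))) :
    δ (∑ I : {s : Finset (Fin (r+q+1)) // s.card = q},
        ∑ J : {s : Finset (Fin (r+p+1)) // s.card = p},
        ((-1 : ℂ) ^ ((∑ i ∈ I.1, ((i : ℕ) + 1)) + ∑ j ∈ J.1, ((j : ℕ) + 1))) •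
          (genericMinor (r+1)
              (Finset.map (Fin.castLEEmb hq) I.1ᶜ)
              (Finset.map (Fin.castLEEmb hp) J.1ᶜ)
              (by rw [Finset.card_map, Finset.card_compl, Fintype.card_fin, I.2]; omega)
              (by rw [Finset.card_map, Finset.card_compl, Fintype.card_fin, J.2]; omega)
            ⊗ₜ[ℂ] wedge (p+q)
              (Fin.append
                (fun t : Fin p =>
                  Xv (⟨0, by omega⟩ : Fin n) (Fin.castLE hp (J.1.orderIsoOfFin J.2 t)))
                (fun t : Fin q =>
                  Xv (Fin.castLE hq (I.1.orderIsoOfFin I.2 t)) (⟨0, by omega⟩ : Fin n))))) =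
      0 := by
  have inj : Function.Injective (LinearMap.lTensor (MvPolynomial (Fin n × Fin n) ℂ)
      (Submodule.subtype (⋀[ℂ]^(p+q-1) ↥(homogeneousSubmodule (Fin n × Fin n) ℂ 1)))) :=
    Module.Flat.lTensor_preserves_injective_linearMap _ (Submodule.subtype_injective _)
  apply inj
  rw [map_zero]
  have hN : r + p + 1 = p + (r + 1) := by omega
  have hN' : r + q + 1 = q + (r + 1) := by omega
  have key := AB hN hN' (R := MvPolynomial (Fin n × Fin n) ℂ)
    (fun i j => X (Fin.castLE hq i, Fin.castLE hp j))
    (fun j => Xv (⟨0, by omega⟩ : Fin n) (Fin.castLE hp j))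
    (fun i => Xv (Fin.castLE hq i) (⟨0, by omega⟩ : Fin n)) rfl
  have key2 := congrArg (fun e => ((-1 : ℂ) ^ (q + p)) • e) key
  simp only [smul_zero] at key2
  rw [← key2, AA, BB, ← Finset.sum_add_distrib, Finset.smul_sum, map_sum, map_sum]
  refine Finset.sum_congr rfl fun I _ => ?_
  rw [← Finset.sum_add_distrib, Finset.smul_sum, map_sum, map_sum]
  refine Finset.sum_congr rfl fun J _ => ?_
  rw [← smul_add, smul_smul, ← sign_split, map_smul, map_smul]
  congr 1
  rw [hδ, boundary _ _ (fun w : ↥(homogeneousSubmodule (Fin n × Fin n) ℂ 1) => (w : MvPolynomial (Fin n × Fin n) ℂ))]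
  have hd : ∀ h1 h2, genericMinor (r+1)
              (Finset.map (Fin.castLEEmb hq) I.1ᶜ)
              (Finset.map (Fin.castLEEmb hp) J.1ᶜ) h1 h2 =
      Matrix.det (Matrix.of fun a b => X (Fin.castLE hq (enc hN' I a), Fin.castLE hp (enc hN J b))) := by
    intro h1 h2
    rw [genericMinor]
    congr 2
    funext a b
    rw [order_map hq _ (card_c hN' I), order_map hp _ (card_c hN J)]
    rfl
  rw [hd]
  rfl
end
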